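/- arXiv:1910.12107 — 6 statements merged into one kernel-verified Lean document; each statement's English description precedes it below -/
import Mathlib

section
/- Let G be a connected infinite simple graph and let k be a natural number. If G admits a distinguishing vertex colouring with k colours (i.e., a function from the vertices of G to a set of k colours such that the identity is the only automorphism of G preserving the colouring), then G admits a distinguishing edge colouring with k+1 colours (i.e., a function from the edges of G to a set of k+1 colours such that the identity is the only automorphism of G preserving the colouring). In other words, D'(G) ≤ D(G) + 1. -/
open SimpleGraph

/-- A vertex colouring is proper if adjacent vertices receive distinct colours. -/
def IsProperVertexColoring {V α : Type*} (G : SimpleGraph V) (c : V → α) : Prop :=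
  ∀ u v, G.Adj u v → c u ≠ c v

/-- A vertex colouring is distinguishing if the identity is the only automorphism
preserving it. -/
def IsDistinguishingVertexColoring {V α : Type*} (G : SimpleGraph V) (c : V → α) : Prop :=
  ∀ φ : G ≃g G, (∀ v, c (φ v) = c v) → ∀ v, φ v = v

/-- An edge colouring is proper if distinct edges sharing a vertex receive distinct
colours. -/
def IsProperEdgeColoring {V α : Type*} (G : SimpleGraph V) (c : Sym2 V → α) : Prop :=
  ∀ u v w, G.Adj u v → G.Adj u w → v ≠ w → c s(u, v) ≠ c s(u, w)

/-- An edge colouring is distinguishing if the identity is the only automorphism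
preserving it. -/
def IsDistinguishingEdgeColoring {V α : Type*} (G : SimpleGraph V) (c : Sym2 V → α) : Prop :=
  ∀ φ : G ≃g G, (∀ u v, G.Adj u v → c s(φ u, φ v) = c s(u, v)) → ∀ v, φ v = v

/-- A total colouring (of vertices and edges) is proper if adjacent vertices get distinct
colours, incident edges get distinct colours, and every vertex gets a colour distinct
from every edge incident with it. -/
def IsProperTotalColoring {V α : Type*} (G : SimpleGraph V) (cv : V → α) (ce : Sym2 V → α) :
    Prop :=
  (∀ u v, G.Adj u v → cv u ≠ cv v) ∧
  (∀ u v w, G.Adj u v → G.Adj u w → v ≠ w → ce s(u, v) ≠ ce s(u, w)) ∧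
  (∀ u v, G.Adj u v → cv u ≠ ce s(u, v))

/-- A total colouring is distinguishing if the identity is the only automorphism
preserving it. -/
def IsDistinguishingTotalColoring {V α : Type*} (G : SimpleGraph V) (cv : V → α)
    (ce : Sym2 V → α) : Prop :=
  ∀ φ : G ≃g G,
    ((∀ v, cv (φ v) = cv v) ∧ (∀ u v, G.Adj u v → ce s(φ u, φ v) = ce s(u, v))) →
    ∀ v, φ v = v

/-- A shortest-path forest towards a vertex set `S`: each vertex outside `S` has a parent which is
one step closer to `S`, and the depth is invariant under automorphisms stabilising `S`. -/
structure DistForest {V : Type*} (G : SimpleGraph V) (S : Set V) where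
  depth : V → ℕ
  parent : V → V
  adj_parent : ∀ v, v ∉ S → G.Adj v (parent v)
  depth_parent : ∀ v, v ∉ S → depth v = depth (parent v) + 1
  depth_map : ∀ φ : G ≃g G, (∀ v, φ v ∈ S ↔ v ∈ S) → ∀ v, depth (φ v) = depth v

theorem dist_map_le {V : Type*} {G : SimpleGraph V} (hG : G.Connected) (φ : G ≃g G) (u v : V) :
    G.dist (φ u) (φ v) ≤ G.dist u v := by
  obtain ⟨p, hp⟩ := hG.exists_walk_length_eq_dist u v
  rw [← hp, ← Walk.length_map φ.toHom p]
  exact dist_le _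

theorem exists_adj_dist_eq {V : Type*} {G : SimpleGraph V} (hG : G.Connected) {u v : V}
    (h : u ≠ v) : ∃ w, G.Adj u w ∧ G.dist u v = G.dist w v + 1 := by
  obtain ⟨p, hp⟩ := hG.exists_walk_length_eq_dist u v
  cases p with
  | nil => exact absurd rfl h
  | cons hadj q =>
    rename_i w
    refine ⟨w, hadj, ?_⟩
    have h1 := dist_le q
    have h2 := hG.dist_triangle (u := u) (v := w) (w := v)
    rw [dist_eq_one_iff_adj.mpr hadj] at h2
    rw [Walk.length_cons] at hp
    omega

theorem nonempty_distForest {V : Type*} {G : SimpleGraph V} (hG : G.Connected) {S : Set V}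
    (hS : S.Nonempty) : Nonempty (DistForest G S) := by
  classical
  let d : V → ℕ := fun v => sInf (G.dist v '' S)
  have hd : ∀ v, ∃ s ∈ S, G.dist v s = d v := fun v => Nat.sInf_mem (hS.image _)
  have hle : ∀ v, ∀ s ∈ S, d v ≤ G.dist v s := fun v s hs => Nat.sInf_le ⟨s, hs, rfl⟩
  have hpar : ∀ v, ∃ w, v ∉ S → G.Adj v w ∧ d v = d w + 1 := by
    intro v
    by_cases hv : v ∈ S
    · exact ⟨v, fun h => absurd hv h⟩
    obtain ⟨s, hs, hvs⟩ := hd v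
    obtain ⟨w, hw, hdist⟩ := exists_adj_dist_eq hG (show v ≠ s by rintro rfl; exact hv hs)
    refine ⟨w, fun _ => ⟨hw, ?_⟩⟩
    obtain ⟨t, ht, hwt⟩ := hd w
    have h1 := hle w s hs
    have h2 := hle v t ht
    have h3 := hG.dist_triangle (u := v) (v := w) (w := t)
    rw [dist_eq_one_iff_adj.mpr hw] at h3
    omega
  have hmap : ∀ φ : G ≃g G, (∀ v, φ v ∈ S ↔ v ∈ S) → ∀ v, d (φ v) ≤ d v := by
    intro φ hφ v
    obtain ⟨s, hs, hvs⟩ := hd v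
    exact (hle _ _ ((hφ s).mpr hs)).trans ((dist_map_le hG φ v s).trans hvs.le)
  choose p hp using hpar
  refine ⟨⟨d, p, fun v hv => (hp v hv).1, fun v hv => (hp v hv).2, fun φ hφ v => ?_⟩⟩
  refine le_antisymm (hmap φ hφ v) ?_
  have := hmap φ.symm (fun w => by rw [← hφ, RelIso.apply_symm_apply]) (φ v)
  rwa [RelIso.symm_apply_apply] at this

namespace DistForest

variable {V : Type*} {G : SimpleGraph V} {S : Set V} {k : ℕ}

open Classical in
/-- The edge joining a vertex outside `S` to its parent receives the colour of that vertex; every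
other edge is coloured by `g`. -/
noncomputable def edgeColoring (F : DistForest G S) (c : V → Fin k)
    (g : Sym2 V → Fin (k + 1)) (e : Sym2 V) : Fin (k + 1) :=
  if h : ∃ v, v ∉ S ∧ e = s(v, F.parent v) then (c h.choose).succ else g e

theorem edgeColoring_parent (F : DistForest G S) (c : V → Fin k) (g : Sym2 V → Fin (k + 1))
    {v : V} (hv : v ∉ S) : F.edgeColoring c g s(v, F.parent v) = (c v).succ := by
  have h : ∃ w, w ∉ S ∧ s(v, F.parent v) = s(w, F.parent w) := ⟨v, hv, rfl⟩
  rw [edgeColoring, dif_pos h]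
  obtain ⟨h1, h2⟩ := h.choose_spec
  rcases Sym2.eq_iff.mp h2 with h3 | ⟨h3, h4⟩
  · rw [← h3.1]
  · have h5 := F.depth_parent _ h1
    have h6 := F.depth_parent _ hv
    rw [← h3] at h5
    rw [h4] at h6
    omega

theorem edgeColoring_of_mem (F : DistForest G S) (c : V → Fin k) (g : Sym2 V → Fin (k + 1))
    {u v : V} (hu : u ∈ S) (hv : v ∈ S) : F.edgeColoring c g s(u, v) = g s(u, v) := by
  rw [edgeColoring, dif_neg]
  rintro ⟨w, hw, h⟩
  rcases Sym2.eq_iff.mp h with h | h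
  · exact hw (h.1 ▸ hu)
  · exact hw (h.2 ▸ hv)

theorem eq_parent_of_edgeColoring_ne (F : DistForest G S) {c : V → Fin k}
    {g : Sym2 V → Fin (k + 1)} {u v : V} (h : F.edgeColoring c g s(u, v) ≠ g s(u, v)) :
    (u ∉ S ∧ v = F.parent u) ∨ (v ∉ S ∧ u = F.parent v) := by
  by_cases h' : ∃ w, w ∉ S ∧ s(u, v) = s(w, F.parent w)
  · obtain ⟨w, hw, h'⟩ := h'
    rcases Sym2.eq_iff.mp h' with ⟨rfl, h'⟩ | ⟨h', rfl⟩
    · exact .inl ⟨hw, h'⟩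
    · exact .inr ⟨hw, h'⟩
  · rw [edgeColoring, dif_neg h'] at h
    exact absurd rfl h

/-- If every automorphism preserving the edge colouring stabilises `S` and preserves the vertex
colours on `S`, then it preserves all vertex colours. -/
theorem isDistinguishing_edgeColoring (F : DistForest G S) {c : V → Fin k}
    (hc : IsDistinguishingVertexColoring G c) {g : Sym2 V → Fin (k + 1)}
    (hg : ∀ u v, u ∉ S → g s(u, v) = 0)
    (hS : ∀ φ : G ≃g G,
      (∀ u v, G.Adj u v → F.edgeColoring c g s(φ u, φ v) = F.edgeColoring c g s(u, v)) →
      (∀ v, φ v ∈ S ↔ v ∈ S) ∧ ∀ v ∈ S, c (φ v) = c v) :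
    IsDistinguishingEdgeColoring G (F.edgeColoring c g) := by
  intro φ hφ
  obtain ⟨hφS, hcS⟩ := hS φ hφ
  refine hc φ fun v => ?_
  by_cases hv : v ∈ S
  · exact hcS v hv
  have hv' : φ v ∉ S := fun h => hv ((hφS v).mp h)
  have h := hφ v _ (F.adj_parent v hv)
  rw [F.edgeColoring_parent c g hv] at h
  have hne : F.edgeColoring c g s(φ v, φ (F.parent v)) ≠ g s(φ v, φ (F.parent v)) := by
    rw [h, hg _ _ hv']
    exact Fin.succ_ne_zero _
  rcases F.eq_parent_of_edgeColoring_ne hne with ⟨_, h1⟩ | ⟨h1, h2⟩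
  · rw [h1, F.edgeColoring_parent c g hv'] at h
    exact Fin.succ_injective _ h
  · have h3 := F.depth_parent _ h1
    rw [← h2, F.depth_map φ hφS, F.depth_map φ hφS] at h3
    have h4 := F.depth_parent v hv
    omega

/-- In an acyclic graph in which `S` is connected by edges inside `S`, every edge is either inside
`S` or joins a vertex to its parent. -/
theorem eq_parent_of_isAcyclic (F : DistForest G S) (hG : G.IsAcyclic)
    (hS : ∀ H : SimpleGraph V, (∀ u ∈ S, ∀ v ∈ S, G.Adj u v → H.Adj u v) →
      ∀ u ∈ S, ∀ v ∈ S, H.Reachable u v)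
    {x y : V} (hxy : G.Adj x y) (hS' : ¬(x ∈ S ∧ y ∈ S)) :
    (x ∉ S ∧ y = F.parent x) ∨ (y ∉ S ∧ x = F.parent y) := by
  by_contra hcon
  have hb : G.IsBridge s(x, y) :=
    (isBridge_iff_forall_cycle_notMem (G.mem_edgeSet.mpr hxy)).mpr
      fun u p hp => absurd hp (hG p)
  rw [isBridge_iff] at hb
  have hreach : ∀ n v, F.depth v = n → ∃ s ∈ S, (G.deleteEdges {s(x, y)}).Reachable v s := by
    intro n
    induction n using Nat.strong_induction_on with
    | _ n ih =>
      intro v hv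
      by_cases hvS : v ∈ S
      · exact ⟨v, hvS, Reachable.refl _⟩
      have h1 := F.depth_parent v hvS
      obtain ⟨s, hs, h2⟩ := ih _ (by omega) (F.parent v) rfl
      refine ⟨s, hs, Reachable.trans (Adj.reachable ?_) h2⟩
      rw [deleteEdges_adj]
      refine ⟨F.adj_parent v hvS, fun h => hcon ?_⟩
      rcases Sym2.eq_iff.mp (Set.mem_singleton_iff.mp h) with ⟨rfl, h'⟩ | ⟨rfl, h'⟩
      · exact .inl ⟨hvS, h'.symm⟩
      · exact .inr ⟨hvS, h'.symm⟩
  obtain ⟨s, hs, hxs⟩ := hreach _ x rfl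
  obtain ⟨t, ht, hyt⟩ := hreach _ y rfl
  refine hb (hxs.trans (Reachable.trans ?_ hyt.symm))
  refine hS _ (fun u hu v hv huv => ?_) s hs t ht
  rw [deleteEdges_adj]
  refine ⟨huv, fun h => hS' ?_⟩
  rcases Sym2.eq_iff.mp (Set.mem_singleton_iff.mp h) with ⟨rfl, rfl⟩ | ⟨rfl, rfl⟩
  · exact ⟨hu, hv⟩
  · exact ⟨hv, hu⟩

end DistForest

/-- In an acyclic graph it suffices to find a connected set `S` without isolated vertices such that
every automorphism stabilising `S` preserves the vertex colours on `S`. -/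
theorem exists_isDistinguishingEdgeColoring_of_isAcyclic {V : Type*} {G : SimpleGraph V}
    (hG : G.Connected) (hac : G.IsAcyclic) {k : ℕ} {c : V → Fin k}
    (hc : IsDistinguishingVertexColoring G c) {S : Set V} (hne : S.Nonempty)
    (hconn : ∀ H : SimpleGraph V, (∀ u ∈ S, ∀ v ∈ S, G.Adj u v → H.Adj u v) →
      ∀ u ∈ S, ∀ v ∈ S, H.Reachable u v)
    (hadj : ∀ v ∈ S, ∃ w ∈ S, G.Adj v w)
    (hS : ∀ φ : G ≃g G, (∀ v, φ v ∈ S ↔ v ∈ S) → ∀ v ∈ S, c (φ v) = c v) :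
    ∃ c' : Sym2 V → Fin (k + 1), IsDistinguishingEdgeColoring G c' := by
  obtain ⟨F⟩ := nonempty_distForest hG hne
  refine ⟨F.edgeColoring c 0, F.isDistinguishing_edgeColoring hc (fun _ _ _ => rfl) ?_⟩
  intro φ hφ
  have hzero : ∀ v w, G.Adj v w → F.edgeColoring c 0 s(v, w) = 0 → v ∈ S := by
    intro v w hvw h0
    by_contra hv
    rcases F.eq_parent_of_isAcyclic hac hconn hvw (fun h => hv h.1) with ⟨h1, rfl⟩ | ⟨h1, rfl⟩
    · rw [F.edgeColoring_parent c 0 h1] at h0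
      exact Fin.succ_ne_zero _ h0
    · rw [Sym2.eq_swap, F.edgeColoring_parent c 0 h1] at h0
      exact Fin.succ_ne_zero _ h0
  have hφS : ∀ v, φ v ∈ S ↔ v ∈ S := by
    intro v
    constructor
    · intro hv
      obtain ⟨w, hw, hvw⟩ := hadj _ hv
      obtain ⟨w, rfl⟩ := φ.surjective w
      have hvw' : G.Adj v w := φ.map_adj_iff.mp hvw
      refine hzero v w hvw' ?_
      rw [← hφ v w hvw', F.edgeColoring_of_mem c 0 hv hw]
      rfl
    · intro hv
      obtain ⟨w, hw, hvw⟩ := hadj _ hv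
      refine hzero _ (φ w) (φ.map_adj_iff.mpr hvw) ?_
      rw [hφ v w hvw, F.edgeColoring_of_mem c 0 hv hw]
      rfl
  exact ⟨hφS, hS φ hφS⟩

/-- An infinite, connected, locally finite graph contains a geodesic ray. -/
theorem exists_geodesic_ray {V : Type*} [Infinite V] {G : SimpleGraph V} (hG : G.Connected)
    (hfin : ∀ v, (G.neighborSet v).Finite) :
    ∃ f : ℕ → V, (∀ n, G.Adj (f n) (f (n + 1))) ∧ ∀ n, G.dist (f 0) (f n) = n := by
  obtain ⟨r⟩ := hG.nonempty
  let B : V → Set V := fun v => {x | G.dist r x = G.dist r v + G.dist v x}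
  have hstep : ∀ v, (B v).Infinite →
      ∃ w, G.Adj v w ∧ G.dist r w = G.dist r v + 1 ∧ (B w).Infinite := by
    intro v hv
    by_contra! hcon
    refine hv (Set.Finite.subset
      ((Set.finite_singleton v).union ((hfin v).biUnion (t := fun w =>
        {x | x ∈ B w ∧ G.dist r w = G.dist r v + 1}) fun w hw => ?_)) ?_)
    · by_cases h : G.dist r w = G.dist r v + 1
      · exact (hcon w hw h).subset fun x hx => hx.1
      · exact Set.finite_empty.subset fun x hx => absurd hx.2 h
    · intro x hx
      by_cases hxv : x = v
      · exact .inl hxv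
      obtain ⟨w, hw, hd⟩ := exists_adj_dist_eq hG (Ne.symm hxv)
      refine .inr (Set.mem_biUnion (x := w) hw ?_)
      have h1 := hG.dist_triangle (u := r) (v := w) (w := x)
      have h2 := hG.dist_triangle (u := r) (v := v) (w := w)
      rw [dist_eq_one_iff_adj.mpr hw] at h2
      have h3 : G.dist r x = G.dist r v + G.dist v x := hx
      exact ⟨show G.dist r x = G.dist r w + G.dist w x by omega, by omega⟩
  have h0 : (B r).Infinite := by
    have : B r = Set.univ := by ext x; simp [B]
    rw [this]
    exact Set.infinite_univ
  choose next hadj hdist hinf using hstep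
  let f : ℕ → {v // (B v).Infinite} :=
    fun n => Nat.rec ⟨r, h0⟩ (fun _ v => ⟨next v.1 v.2, hinf v.1 v.2⟩) n
  refine ⟨fun n => (f n).1, fun n => hadj _ (f n).2, fun n => ?_⟩
  induction n with
  | zero => exact dist_self
  | succ n ih =>
    have h : G.dist r (f (n + 1)).1 = G.dist r (f n).1 + 1 := hdist _ (f n).2
    exact h.trans (congrArg (· + 1) ih)

/-- An automorphism stabilising a geodesic ray fixes it pointwise. -/
theorem apply_geodesic_ray_eq {V : Type*} {G : SimpleGraph V} (hG : G.Connected) {f : ℕ → V}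
    (hadj : ∀ n, G.Adj (f n) (f (n + 1))) (hdist : ∀ n, G.dist (f 0) (f n) = n)
    (φ : G ≃g G) (hφ : ∀ v, φ v ∈ Set.range f ↔ v ∈ Set.range f) (n : ℕ) : φ (f n) = f n := by
  have hinj : ∀ m n, f m = f n → m = n := by
    intro m n h
    rw [← hdist m, ← hdist n, h]
  have hnear : ∀ m n, G.Adj (f m) (f n) → n = m + 1 ∨ m = n + 1 := by
    intro m n h
    have h1 := hG.dist_triangle (u := f 0) (v := f m) (w := f n)
    have h2 := hG.dist_triangle (u := f 0) (v := f n) (w := f m)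
    rw [dist_eq_one_iff_adj.mpr h, hdist, hdist] at h1
    rw [dist_eq_one_iff_adj.mpr h.symm, hdist, hdist] at h2
    have h3 : m ≠ n := by rintro rfl; exact h.ne rfl
    omega
  have hσ : ∀ n, ∃ m, φ (f n) = f m := fun n => by
    obtain ⟨m, hm⟩ := (hφ (f n)).mpr ⟨n, rfl⟩
    exact ⟨m, hm.symm⟩
  have hτ : ∀ n, ∃ m, φ (f m) = f n := fun n => by
    obtain ⟨x, hx⟩ := φ.surjective (f n)
    obtain ⟨m, rfl⟩ := (hφ x).mp (hx ▸ ⟨n, rfl⟩)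
    exact ⟨m, hx⟩
  have hzero : φ (f 0) = f 0 := by
    obtain ⟨m, hm⟩ := hσ 0
    cases m with
    | zero => exact hm
    | succ m =>
      obtain ⟨a, ha⟩ := hτ m
      obtain ⟨b, hb⟩ := hτ (m + 1 + 1)
      have h1 : G.Adj (f 0) (f a) := by
        rw [← φ.map_adj_iff, hm, ha]
        exact (hadj m).symm
      have h2 : G.Adj (f 0) (f b) := by
        rw [← φ.map_adj_iff, hm, hb]
        exact hadj (m + 1)
      have h3 : a = b := by
        have := hnear _ _ h1
        have := hnear _ _ h2
        omega
      subst h3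
      have := hinj _ _ (ha.symm.trans hb)
      omega
  induction n using Nat.strong_induction_on with
  | _ n ih =>
    cases n with
    | zero => exact hzero
    | succ n =>
      obtain ⟨m, hm⟩ := hσ (n + 1)
      have h1 : G.Adj (f n) (f m) := by
        rw [← hm, ← ih n (by omega), φ.map_adj_iff]
        exact hadj n
      rcases hnear _ _ h1 with rfl | rfl
      · exact hm
      · have := hinj _ _ (φ.injective (hm.trans (ih m (by omega)).symm))
        omega

theorem exists_isDistinguishingEdgeColoring_of_isAcyclic_of_infinite {V : Type*} [Infinite V]
    {G : SimpleGraph V} (hG : G.Connected) (hac : G.IsAcyclic) {k : ℕ} {c : V → Fin k}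
    (hc : IsDistinguishingVertexColoring G c) :
    ∃ c' : Sym2 V → Fin (k + 1), IsDistinguishingEdgeColoring G c' := by
  by_cases h1 : ∃ u v, G.Adj u v ∧ c u = c v
  · obtain ⟨u, v, huv, hcuv⟩ := h1
    refine exists_isDistinguishingEdgeColoring_of_isAcyclic hG hac hc (S := {u, v}) ⟨u, by simp⟩
      ?_ ?_ ?_
    · rintro H hH a (rfl | rfl) b (rfl | rfl)
      · exact Reachable.refl _
      · exact (hH _ (by simp) _ (by simp) huv).reachable
      · exact (hH _ (by simp) _ (by simp) huv.symm).reachable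
      · exact Reachable.refl _
    · rintro a (rfl | rfl)
      · exact ⟨v, by simp, huv⟩
      · exact ⟨u, by simp, huv.symm⟩
    · intro φ hφ
      have hcol : ∀ w ∈ ({u, v} : Set V), c w = c u := by
        rintro w (rfl | rfl)
        · rfl
        · exact hcuv.symm
      intro w hw
      rw [hcol w hw, hcol _ ((hφ w).mpr hw)]
  push Not at h1
  by_cases h2 : ∃ u v w, G.Adj v u ∧ G.Adj v w ∧ u ≠ w ∧ c u = c w
  · obtain ⟨u, v, w, hvu, hvw, huw, hcuw⟩ := h2
    have hnadj : ¬G.Adj u w := fun h => h1 u w h hcuw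
    refine exists_isDistinguishingEdgeColoring_of_isAcyclic hG hac hc (S := {u, v, w})
      ⟨u, by simp⟩ ?_ ?_ ?_
    · intro H hH
      have h3 : ∀ a ∈ ({u, v, w} : Set V), H.Reachable a v := by
        rintro a (rfl | rfl | rfl)
        · exact (hH _ (by simp) _ (by simp) hvu.symm).reachable
        · exact Reachable.refl _
        · exact (hH _ (by simp) _ (by simp) hvw.symm).reachable
      exact fun a ha b hb => (h3 a ha).trans (h3 b hb).symm
    · rintro a (rfl | rfl | rfl)
      · exact ⟨v, by simp, hvu.symm⟩
      · exact ⟨u, by simp, hvu⟩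
      · exact ⟨v, by simp, hvw.symm⟩
    · intro φ hφ
      have hu := (hφ u).mpr (by simp)
      have hv := (hφ v).mpr (by simp)
      have hw := (hφ w).mpr (by simp)
      have hvu' : G.Adj (φ v) (φ u) := φ.map_adj_iff.mpr hvu
      have hvw' : G.Adj (φ v) (φ w) := φ.map_adj_iff.mpr hvw
      have huw' : φ u ≠ φ w := fun h => huw (φ.injective h)
      have hnadj' : ¬G.Adj w u := fun h => hnadj h.symm
      simp only [Set.mem_insert_iff, Set.mem_singleton_iff] at hu hv hw
      have hfix : φ v = v := by
        rcases hv with hv | hv | hv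
        · rw [hv] at hvu' hvw'
          rcases hu with hu | hu | hu <;> rcases hw with hw | hw | hw <;> simp_all
        · exact hv
        · rw [hv] at hvu' hvw'
          rcases hu with hu | hu | hu <;> rcases hw with hw | hw | hw <;> simp_all
      have hnv : ∀ x, x ≠ v → φ x ≠ v := fun x hx h => hx (φ.injective (h.trans hfix.symm))
      have hu' := hnv u hvu.ne'
      have hw' := hnv w hvw.ne'
      rintro x (rfl | rfl | rfl)
      · rcases hu with hu | hu | hu
        · rw [hu]
        · exact absurd hu hu'
        · rw [hu, hcuw]
      · rw [hfix]
      · rcases hw with hw | hw | hw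
        · rw [hw, hcuw]
        · exact absurd hw hw'
        · rw [hw]
  push Not at h2
  have hfin : ∀ v, (G.neighborSet v).Finite := by
    intro v
    refine Set.Finite.of_finite_image (f := c) (Set.toFinite _) fun a ha b hb hab => ?_
    by_contra hne
    exact h2 a v b ha hb hne hab
  obtain ⟨f, hadj, hdist⟩ := exists_geodesic_ray hG hfin
  refine exists_isDistinguishingEdgeColoring_of_isAcyclic hG hac hc (S := Set.range f)
    ⟨f 0, 0, rfl⟩ ?_ ?_ ?_
  · intro H hH
    have h3 : ∀ n, H.Reachable (f 0) (f n) := by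
      intro n
      induction n with
      | zero => exact Reachable.refl _
      | succ n ih => exact ih.trans (hH _ ⟨n, rfl⟩ _ ⟨n + 1, rfl⟩ (hadj n)).reachable
    rintro _ ⟨m, rfl⟩ _ ⟨n, rfl⟩
    exact (h3 m).symm.trans (h3 n)
  · rintro _ ⟨n, rfl⟩
    exact ⟨_, ⟨n + 1, rfl⟩, hadj n⟩
  · rintro φ hφ _ ⟨n, rfl⟩
    rw [apply_geodesic_ray_eq hG hadj hdist φ hφ n]

theorem natCast_zmod_ne_zero {n m : ℕ} (h0 : m ≠ 0) (hm : m < n) : (m : ZMod n) ≠ 0 := by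
  rw [Ne, ZMod.natCast_eq_zero_iff]
  exact fun h => absurd (Nat.le_of_dvd (Nat.pos_of_ne_zero h0) h) (by omega)

/-- For every vertex colouring `c` of a cycle there is an edge colouring `D` with the same colours,
where `D i` is the colour of the edge from `i` to `i + 1`, such that every symmetry of the cycle
preserving `D` preserves `c`. -/
theorem exists_cycle_edgeColoring {n k : ℕ} (hn : 3 ≤ n) (hk : 2 ≤ k) (c : ZMod n → Fin k) :
    ∃ D : ZMod n → Fin k, ∀ a, ((∀ i, D (a + i) = D i) → ∀ i, c (a + i) = c i) ∧
      ((∀ i, D (a - i - 1) = D i) → ∀ i, c (a - i) = c i) := by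
  rcases Nat.even_or_odd n with he | ⟨m, hm⟩
  swap
  · have hh : (m + 1 : ZMod n) + (m + 1) = 1 := by
      have : ((2 * m + 1 : ℕ) : ZMod n) = 0 := by rw [← hm, ZMod.natCast_self]
      push_cast at this
      linear_combination this
    refine ⟨fun i => c (i + (m + 1)), fun a => ⟨fun h i => ?_, fun h i => ?_⟩⟩
    · have := h (i - (m + 1))
      simp only [sub_add_cancel] at this
      rw [← this]
      congr 1
      ring
    · have := h (i - (m + 1))
      simp only [sub_add_cancel] at this
      rw [← this]
      congr 1
      linear_combination -hh
  by_cases h6 : 6 ≤ n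
  · let D : ZMod n → Fin k := fun i => if i = 0 ∨ i = 2 ∨ i = 3 then ⟨1, hk⟩ else ⟨0, by omega⟩
    have hD : ∀ i j, D i = D j → (j = 0 ∨ j = 2 ∨ j = 3) → (i = 0 ∨ i = 2 ∨ i = 3) := by
      intro i j h hj
      by_contra hi
      simp [D, hi, hj] at h
    have e1 : (1 : ZMod n) ≠ 0 := by
      exact_mod_cast natCast_zmod_ne_zero (m := 1) (n := n) (by omega) (by omega)
    have e2 : (2 : ZMod n) ≠ 0 := by
      exact_mod_cast natCast_zmod_ne_zero (m := 2) (n := n) (by omega) (by omega)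
    have e3 : (3 : ZMod n) ≠ 0 := by
      exact_mod_cast natCast_zmod_ne_zero (m := 3) (n := n) (by omega) (by omega)
    have e4 : (4 : ZMod n) ≠ 0 := by
      exact_mod_cast natCast_zmod_ne_zero (m := 4) (n := n) (by omega) (by omega)
    have e5 : (5 : ZMod n) ≠ 0 := by
      exact_mod_cast natCast_zmod_ne_zero (m := 5) (n := n) (by omega) (by omega)
    refine ⟨D, fun a => ⟨fun h => ?_, fun h => ?_⟩⟩
    · have ha : a = 0 := by
        have h0 := hD _ _ (h 0) (by simp)
        have h2 := hD _ _ (h 2) (by simp)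
        have h3 := hD _ _ (h 3) (by simp)
        rw [add_zero] at h0
        rcases h0 with rfl | rfl | rfl
        · rfl
        · rcases h2 with h | h | h
          · exact absurd (by linear_combination h) e4
          · exact absurd (by linear_combination h) e2
          · exact absurd (by linear_combination h) e1
        · rcases h2 with h | h | h
          · exact absurd (by linear_combination h) e5
          · exact absurd (by linear_combination h) e3
          · exact absurd (by linear_combination h) e2
      intro i
      rw [ha, zero_add]
    · exfalso
      have h0 := hD _ _ (h 0) (by simp)
      have h2 := hD _ _ (h 2) (by simp)
      have h3 := hD _ _ (h 3) (by simp)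
      rcases h0 with h0 | h0 | h0
      · rcases h2 with h | h | h
        · exact absurd (by linear_combination h0 - h) e2
        · exact absurd (by linear_combination h0 - h) e4
        · exact absurd (by linear_combination h0 - h) e5
      · rcases h3 with h | h | h
        · exact absurd (by linear_combination h0 - h) e1
        · exact absurd (by linear_combination h0 - h) e3
        · exact absurd (by linear_combination h0 - h) e4
      · rcases h2 with h | h | h
        · exact absurd (by linear_combination h - h0) e1
        · exact absurd (by linear_combination h0 - h) e1
        · exact absurd (by linear_combination h0 - h) e2
  obtain rfl : n = 4 := by
    obtain ⟨m, rfl⟩ := he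
    omega
  by_cases hk3 : 3 ≤ k
  · obtain ⟨D, key⟩ : ∃ D : ZMod 4 → Fin 3, ∀ a : ZMod 4,
        ((∀ i, D (a + i) = D i) → a = 0) ∧ ¬∀ i, D (a - i - 1) = D i := by
      refine ⟨![0, 0, 1, 2], ?_⟩
      unfold ZMod
      decide
    refine ⟨fun i => Fin.castLE hk3 (D i), fun a => ⟨fun h i => ?_, fun h => ?_⟩⟩
    · rw [(key a).1 fun i => Fin.castLE_injective hk3 (h i), zero_add]
    · exact absurd (fun i => Fin.castLE_injective hk3 (h i)) (key a).2
  obtain rfl : k = 2 := by omega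
  clear hn hk he h6 hk3
  revert c
  unfold ZMod
  decide +revert

theorem eq_add_or_eq_sub_of_injective {n : ℕ} (hn : 3 ≤ n) {ψ : ZMod n → ZMod n}
    (hinj : Function.Injective ψ) (h : ∀ i, ψ (i + 1) = ψ i + 1 ∨ ψ i = ψ (i + 1) + 1) :
    (∀ i, ψ i = ψ 0 + i) ∨ (∀ i, ψ i = ψ 0 - i) := by
  have : NeZero n := ⟨by omega⟩
  have h2 : (2 : ZMod n) ≠ 0 := by
    exact_mod_cast natCast_zmod_ne_zero (m := 2) (n := n) (by omega) (by omega)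
  have hne : ∀ i, ψ (i + 1 + 1) ≠ ψ i := fun i he => h2 (by linear_combination hinj he)
  rcases h 0 with h0 | h0
  · left
    have key : ∀ m : ℕ, ψ (m + 1) = ψ m + 1 := by
      intro m
      induction m with
      | zero => simpa using h0
      | succ m ih =>
        push_cast
        rcases h (m + 1) with h' | h'
        · exact h'
        · exact absurd (by linear_combination ih - h') (hne m)
    intro i
    obtain ⟨m, rfl⟩ := ZMod.natCast_zmod_surjective i
    induction m with
    | zero => simp
    | succ m ih => push_cast; rw [key, ih]; ring
  · right
    have key : ∀ m : ℕ, ψ m = ψ (m + 1) + 1 := by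
      intro m
      induction m with
      | zero => simpa using h0
      | succ m ih =>
        push_cast
        rcases h (m + 1) with h' | h'
        · exact absurd (by linear_combination h' - ih) (hne m)
        · exact h'
    intro i
    obtain ⟨m, rfl⟩ := ZMod.natCast_zmod_surjective i
    induction m with
    | zero => simp
    | succ m ih => push_cast; linear_combination ih - key m

theorem exists_zmod_cycle {V : Type*} {G : SimpleGraph V} (h : ¬G.IsAcyclic) :
    ∃ n, 3 ≤ n ∧ ∃ f : ZMod n → V, Function.Injective f ∧ ∀ i, G.Adj (f i) (f (i + 1)) := by
  simp only [IsAcyclic, not_forall, not_not] at h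
  obtain ⟨v, w, hw⟩ := h
  have hn := hw.three_le_length
  have : NeZero w.length := ⟨by omega⟩
  have : Fact (1 < w.length) := ⟨by omega⟩
  refine ⟨w.length, hn, fun i => w.getVert i.val, fun i j hij => ?_, fun i => ?_⟩
  · have hi := ZMod.val_lt i
    have hj := ZMod.val_lt j
    exact ZMod.val_injective _ (hw.getVert_injOn' (by simp; omega) (by simp; omega) hij)
  · have hi := ZMod.val_lt i
    have hadj := w.adj_getVert_succ hi
    have hval : (i + 1).val = (i.val + 1) % w.length := by rw [ZMod.val_add, ZMod.val_one]
    change G.Adj (w.getVert i.val) (w.getVert (i + 1).val)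
    rcases Nat.lt_or_eq_of_le (Nat.succ_le_of_lt hi) with hlt | heq
    · rwa [hval, Nat.mod_eq_of_lt hlt]
    · have heq' : i.val + 1 = w.length := heq
      rw [heq', Walk.getVert_length] at hadj
      rwa [hval, heq', Nat.mod_self, Walk.getVert_zero]

open Classical in
/-- The edge colouring giving the edge from `f i` to `f (i + 1)` the nonzero colour `D i`, and
all other edges the colour `0`. -/
noncomputable def cycleColoring {V : Type*} {n k : ℕ} (f : ZMod n → V) (D : ZMod n → Fin k)
    (e : Sym2 V) : Fin (k + 1) :=
  if h : ∃ i, e = s(f i, f (i + 1)) then (D h.choose).succ else 0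

theorem cycleColoring_apply {V : Type*} {n k : ℕ} (hn : 3 ≤ n) {f : ZMod n → V}
    (hf : Function.Injective f) (D : ZMod n → Fin k) (i : ZMod n) :
    cycleColoring f D s(f i, f (i + 1)) = (D i).succ := by
  have h2 : (2 : ZMod n) ≠ 0 := by
    exact_mod_cast natCast_zmod_ne_zero (m := 2) (n := n) (by omega) (by omega)
  have h : ∃ j, s(f i, f (i + 1)) = s(f j, f (j + 1)) := ⟨i, rfl⟩
  rw [cycleColoring, dif_pos h]
  rcases Sym2.eq_iff.mp h.choose_spec with h3 | ⟨h3, h4⟩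
  · rw [← hf h3.1]
  · exact absurd (by linear_combination hf h4 - hf h3) h2

theorem exists_isDistinguishingEdgeColoring_of_not_isAcyclic {V : Type*} {G : SimpleGraph V}
    (hG : G.Connected) (hac : ¬G.IsAcyclic) {k : ℕ} (hk : 2 ≤ k) {c : V → Fin k}
    (hc : IsDistinguishingVertexColoring G c) :
    ∃ c' : Sym2 V → Fin (k + 1), IsDistinguishingEdgeColoring G c' := by
  obtain ⟨n, hn, f, hf, hadj⟩ := exists_zmod_cycle hac
  have : NeZero n := ⟨by omega⟩
  have h2 : (2 : ZMod n) ≠ 0 := by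
    exact_mod_cast natCast_zmod_ne_zero (m := 2) (n := n) (by omega) (by omega)
  obtain ⟨D, hD⟩ := exists_cycle_edgeColoring hn hk (c ∘ f)
  obtain ⟨F⟩ := nonempty_distForest hG (S := Set.range f) ⟨f 0, 0, rfl⟩
  have hg : ∀ u v, u ∉ Set.range f → cycleColoring f D s(u, v) = 0 := by
    intro u v hu
    rw [cycleColoring, dif_neg]
    rintro ⟨i, hi⟩
    rcases Sym2.eq_iff.mp hi with h | h
    · exact hu ⟨i, h.1.symm⟩
    · exact hu ⟨i + 1, h.1.symm⟩
  refine ⟨_, F.isDistinguishing_edgeColoring hc hg fun φ hφ => ?_⟩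
  have hcol : ∀ i, F.edgeColoring c (cycleColoring f D) s(φ (f i), φ (f (i + 1))) = (D i).succ := by
    intro i
    rw [hφ _ _ (hadj i), F.edgeColoring_of_mem _ _ ⟨i, rfl⟩ ⟨i + 1, rfl⟩,
      cycleColoring_apply hn hf]
  have hsub : ∀ i, φ (f i) ∈ Set.range f := by
    by_contra! hcon
    obtain ⟨i, hi, hmax⟩ := Set.exists_max_image {i | φ (f i) ∉ Set.range f}
      (fun i => F.depth (φ (f i))) (Set.toFinite _) hcon
    have hpar : ∀ j, F.edgeColoring c (cycleColoring f D) s(φ (f i), φ (f j)) ≠ 0 →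
        φ (f j) = F.parent (φ (f i)) := by
      intro j hj
      rw [← hg _ (φ (f j)) hi] at hj
      rcases F.eq_parent_of_edgeColoring_ne hj with h | ⟨h, h'⟩
      · exact h.2
      · have h3 := hmax j h
        have h4 := F.depth_parent _ h
        rw [← h'] at h4
        omega
    have h3 := hpar (i + 1) (by rw [hcol]; exact Fin.succ_ne_zero _)
    have h4 := hpar (i - 1) (by
      have := hcol (i - 1)
      rw [sub_add_cancel] at this
      rw [Sym2.eq_swap, this]
      exact Fin.succ_ne_zero _)
    exact h2 (by linear_combination hf (φ.injective (h3.trans h4.symm)))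
  choose ψ hψ using hsub
  have hψinj : Function.Injective ψ := fun i j hij =>
    hf (φ.injective (by rw [← hψ, ← hψ, hij]))
  have hφS : ∀ v, φ v ∈ Set.range f ↔ v ∈ Set.range f := by
    intro v
    constructor
    · rintro ⟨j, hj⟩
      obtain ⟨i, rfl⟩ := (Finite.injective_iff_surjective.mp hψinj) j
      exact ⟨i, φ.injective ((hψ i).symm.trans hj)⟩
    · rintro ⟨i, rfl⟩
      exact ⟨ψ i, hψ i⟩
  have hcol' : ∀ i, cycleColoring f D s(f (ψ i), f (ψ (i + 1))) = (D i).succ := by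
    intro i
    rw [← hcol, ← hψ, ← hψ, F.edgeColoring_of_mem _ _ ⟨_, rfl⟩ ⟨_, rfl⟩]
  have hstep : ∀ i, ψ (i + 1) = ψ i + 1 ∨ ψ i = ψ (i + 1) + 1 := by
    intro i
    by_contra hcon
    have h := hcol' i
    rw [cycleColoring, dif_neg] at h
    · exact Fin.succ_ne_zero _ h.symm
    · rintro ⟨j, hj⟩
      rcases Sym2.eq_iff.mp hj with ⟨h3, h4⟩ | ⟨h3, h4⟩
      · exact hcon (.inl (by rw [hf h3, hf h4]))
      · exact hcon (.inr (by rw [hf h3, hf h4]))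
  refine ⟨hφS, ?_⟩
  rintro _ ⟨i, rfl⟩
  rw [← hψ]
  rcases eq_add_or_eq_sub_of_injective hn hψinj hstep with h | h
  · rw [h]
    refine (hD (ψ 0)).1 (fun j => Fin.succ_injective _ ?_) i
    rw [← hcol' j, h (j + 1), h j, ← add_assoc, cycleColoring_apply hn hf]
  · rw [h]
    refine (hD (ψ 0)).2 (fun j => Fin.succ_injective _ ?_) i
    rw [← hcol' j, h (j + 1), h j, ← sub_sub, Sym2.eq_swap]
    conv_rhs => rw [← sub_add_cancel (ψ 0 - j) 1]
    rw [add_sub_cancel_right, cycleColoring_apply hn hf]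

/-- If a connected infinite graph admits a distinguishing vertex colouring with `k`
colours, then it admits a distinguishing edge colouring with `k + 1` colours;
i.e. `D'(G) ≤ D(G) + 1`. -/
theorem distinguishingIndex_le_distinguishingNumber_add_one
    {V : Type*} [Infinite V] (G : SimpleGraph V) (hG : G.Connected) (k : ℕ)
    (c : V → Fin k) (hc : IsDistinguishingVertexColoring G c) :
    ∃ c' : Sym2 V → Fin (k + 1), IsDistinguishingEdgeColoring G c' := by
  by_cases hac : G.IsAcyclic
  · exact exists_isDistinguishingEdgeColoring_of_isAcyclic_of_infinite hG hac hc
  by_cases hk : 2 ≤ k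
  · exact exists_isDistinguishingEdgeColoring_of_not_isAcyclic hG hac hk hc
  · have : Subsingleton (Fin k) := Fin.subsingleton_iff_le_one.mpr (by omega)
    exact ⟨0, fun φ _ => hc φ fun v => Subsingleton.elim _ _⟩
end

section
/- Let G be a connected infinite simple graph whose maximum degree Δ is finite. Then G admits a proper vertex colouring with 2Δ − 1 colours that is preserved only by the identity automorphism; that is, χ_D(G) ≤ 2Δ − 1. -/
open SimpleGraph

/-- `p` is the least neighbour of `v`, and it precedes `v`. -/
def IsParent {V : Type*} [LinearOrder V] (G : SimpleGraph V) (p v : V) : Prop :=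
  G.Adj p v ∧ p < v ∧ ∀ u, G.Adj u v → p ≤ u

theorem IsParent.unique {V : Type*} [LinearOrder V] {G : SimpleGraph V} {p q v : V}
    (hp : IsParent G p v) (hq : IsParent G q v) : p = q :=
  le_antisymm (hp.2.2 q hq.1) (hq.2.2 p hp.1)

/-- In a connected graph, a nonempty set of vertices closed under adjacency is everything. -/
theorem mem_of_closed_of_connected {V : Type*} {G : SimpleGraph V} (hG : G.Connected)
    {S : Set V} {o : V} (ho : o ∈ S) (hS : ∀ u v, u ∈ S → G.Adj u v → v ∈ S) (v : V) :
    v ∈ S := by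
  obtain ⟨p⟩ := hG o v
  induction p with
  | nil => exact ho
  | cons h _ ih => exact ih (hS _ _ ho h)

/-- A vertex other than the root of a connected graph has a neighbour closer to the root. -/
theorem exists_adj_dist_lt {V : Type*} {G : SimpleGraph V} (hG : G.Connected) {x v : V}
    (hv : v ≠ x) : ∃ u, G.Adj u v ∧ G.dist x u < G.dist x v := by
  obtain ⟨p, hp⟩ := hG.exists_walk_length_eq_dist v x
  cases p with
  | nil => exact absurd rfl hv
  | cons h q =>
    refine ⟨_, h.symm, ?_⟩
    rw [dist_comm, dist_comm (u := x), ← hp, Walk.length_cons]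
    exact Nat.lt_succ_of_le (dist_le q)

/-- The vertices of a graph can be well-ordered by their distance from a root. -/
theorem exists_wellOrder_of_dist {V : Type*} (G : SimpleGraph V) (x : V) :
    ∃ (_ : LinearOrder V) (_ : WellFoundedLT V),
      ∀ u v : V, G.dist x u < G.dist x v → u < v := by
  obtain ⟨_, _⟩ := exists_wellFoundedLT V
  let f : V → ℕ ×ₗ V := fun v => toLex (G.dist x v, v)
  have hf : Function.Injective f := fun u v h => congrArg (fun a => (ofLex a).2) h
  have hlt : ∀ u v : V, G.dist x u < G.dist x v → f u < f v := fun u v h =>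
    Prod.Lex.toLex_lt_toLex.2 (Or.inl h)
  have hwf : WellFounded (fun u v : V => f u < f v) :=
    InvImage.wf f (WellFounded.prod_lex wellFounded_lt wellFounded_lt)
  exact ⟨LinearOrder.lift' f hf, ⟨hwf⟩, hlt⟩

theorem exists_isParent {V : Type*} [LinearOrder V] [WellFoundedLT V] {G : SimpleGraph V}
    (hG : G.Connected) {x : V} (hlt : ∀ u v : V, G.dist x u < G.dist x v → u < v) {v : V}
    (hv : v ≠ x) : ∃ p, IsParent G p v := by
  obtain ⟨u, huv, hu⟩ := exists_adj_dist_lt hG hv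
  have hne : {w | G.Adj w v}.Nonempty := ⟨u, huv⟩
  have hmin : ∀ w, G.Adj w v → wellFounded_lt.min _ hne ≤ w := fun w hw =>
    not_lt.1 (wellFounded_lt.not_lt_min (s := {w | G.Adj w v}) hw)
  exact ⟨wellFounded_lt.min _ hne, wellFounded_lt.min_mem _ hne,
    lt_of_le_of_lt (hmin u huv) (hlt _ _ hu), hmin⟩

/-- Greedy extension of a partial colouring along a well-order: each new vertex avoids the
colours already present in `F v`, and uses the colour `red` only if it has to. -/
theorem exists_greedy_extension {V α : Type*} [Finite α] [LinearOrder V] [WellFoundedLT V]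
    (F : V → Set V) (P : Set V) (c₀ : V → α) (red : α)
    (hF : ∀ v ∉ P, (F v).Finite ∧ (F v).ncard < Nat.card α) :
    ∃ c : V → α, Set.EqOn c c₀ P ∧ ∀ v ∉ P,
      (∀ u ∈ F v, u ∈ P ∨ u < v → c v ≠ c u) ∧
      (c v = red → ∀ a, a ≠ red → ∃ u ∈ F v, (u ∈ P ∨ u < v) ∧ c u = a) := by
  classical
  have hpick : ∀ S : Set α, ∃ a, S ≠ Set.univ → a ∉ S ∧ (a = red → ∀ b, b ≠ red → b ∈ S) := by
    intro S
    by_cases h : ∃ b, b ≠ red ∧ b ∉ S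
    · obtain ⟨b, hb, hbS⟩ := h
      exact ⟨b, fun _ => ⟨hbS, fun h => absurd h hb⟩⟩
    · push Not at h
      refine ⟨red, fun hS => ⟨fun hr => hS ?_, fun _ => h⟩⟩
      refine Set.eq_univ_of_forall fun b => ?_
      by_cases hb : b = red
      · exact hb ▸ hr
      · exact h b hb
  choose pick hpick using hpick
  let body : (v : V) → ((u : V) → u < v → α) → α := fun v ih =>
    if v ∈ P then c₀ v else
      pick {a | ∃ u ∈ F v, (u ∈ P ∧ c₀ u = a) ∨ ∃ h : u < v, ih u h = a}
  let c : V → α := wellFounded_lt.fix body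
  have hc : ∀ v, c v = body v fun u _ => c u := fun v => wellFounded_lt.fix_eq body v
  have hcP : ∀ v ∈ P, c v = c₀ v := fun v hv => by
    rw [hc]; exact if_pos hv
  refine ⟨c, hcP, fun v hv => ?_⟩
  set S : Set α := {a | ∃ u ∈ F v, (u ∈ P ∨ u < v) ∧ c u = a}
  have hcv : c v = pick S := by
    rw [hc]
    refine (if_neg hv).trans (congrArg pick ?_)
    ext a
    constructor
    · rintro ⟨u, hu, ⟨h, rfl⟩ | ⟨h, rfl⟩⟩
      · exact ⟨u, hu, Or.inl h, hcP u h⟩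
      · exact ⟨u, hu, Or.inr h, rfl⟩
    · rintro ⟨u, hu, h | h, rfl⟩
      · exact ⟨u, hu, Or.inl ⟨h, (hcP u h).symm⟩⟩
      · exact ⟨u, hu, Or.inr ⟨h, rfl⟩⟩
  have hSne : S ≠ Set.univ := by
    intro h
    have hsub : S ⊆ c '' F v := by
      rintro a ⟨u, hu, -, rfl⟩
      exact ⟨u, hu, rfl⟩
    have h1 := Set.ncard_le_ncard hsub ((hF v hv).1.image c)
    have h2 := Set.ncard_image_le (f := c) (hF v hv).1
    have h3 := (hF v hv).2
    rw [h, Set.ncard_univ] at h1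
    omega
  obtain ⟨h1, h2⟩ := hpick S hSne
  rw [← hcv] at h1 h2
  refine ⟨fun u hu hu' h => h1 ⟨u, hu, hu', h.symm⟩, fun hr a ha => h2 hr a ha⟩

/-- A vertex with a parent other than the root has at most `Δ - 2` siblings. -/
theorem ncard_siblings_add_two_le {V : Type*} [LinearOrder V] [WellFoundedLT V]
    {G : SimpleGraph V} (hG : G.Connected) {Δ : ℕ}
    (hdeg : ∀ v, (G.neighborSet v).Finite ∧ (G.neighborSet v).ncard ≤ Δ) {x : V}
    (hlt : ∀ u v : V, G.dist x u < G.dist x v → u < v) {p v : V} (hp : p ≠ x)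
    (hpv : IsParent G p v) :
    {w | w ≠ v ∧ IsParent G p w}.Finite ∧ {w | w ≠ v ∧ IsParent G p w}.ncard + 2 ≤ Δ := by
  obtain ⟨q, hq⟩ := exists_isParent hG hlt hp
  have hfin : {w | w ≠ v ∧ IsParent G p w}.Finite :=
    (hdeg p).1.subset fun w hw => hw.2.1
  refine ⟨hfin, ?_⟩
  have hq' : q ∉ {w | w ≠ v ∧ IsParent G p w} := fun h => lt_asymm h.2.2.1 hq.2.1
  have hv' : v ∉ insert q {w | w ≠ v ∧ IsParent G p w} := by
    rintro (h | h)
    · exact lt_asymm hpv.2.1 (h ▸ hq.2.1)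
    · exact h.1 rfl
  have hsub : insert v (insert q {w | w ≠ v ∧ IsParent G p w}) ⊆ G.neighborSet p := by
    rintro w (rfl | rfl | h)
    · exact hpv.1
    · exact hq.1.symm
    · exact h.2.1
  have h := Set.ncard_le_ncard hsub (hdeg p).1
  rw [Set.ncard_insert_of_notMem hv' (hfin.insert q), Set.ncard_insert_of_notMem hq' hfin] at h
  exact h.trans (hdeg p).2

/-- A proper partial colouring of a set containing the closed neighbourhood of the root extends
to a proper colouring with `2 * Δ - 1` colours in which siblings away from the root have
different colours, and in which every new `red` vertex has full degree, differently coloured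
neighbours, and only neighbours that are precoloured or precede it. -/
theorem exists_coloring_extension {V α : Type*} [Finite α] [LinearOrder V] [WellFoundedLT V]
    {G : SimpleGraph V} (hG : G.Connected) {Δ : ℕ}
    (hdeg : ∀ v, (G.neighborSet v).Finite ∧ (G.neighborSet v).ncard ≤ Δ) {x : V}
    (hlt : ∀ u v : V, G.dist x u < G.dist x v → u < v) (hα : Nat.card α + 1 = 2 * Δ)
    (red : α) (P : Set V) (hxP : x ∈ P) (hNP : G.neighborSet x ⊆ P) (c₀ : V → α)
    (hproper : ∀ u ∈ P, ∀ v ∈ P, G.Adj u v → c₀ u ≠ c₀ v)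
    (hsib : ∀ p u v, p ≠ x → u ∈ P → v ∈ P → IsParent G p u → IsParent G p v → u ≠ v →
      c₀ u ≠ c₀ v) :
    ∃ c : V → α, Set.EqOn c c₀ P ∧ IsProperVertexColoring G c ∧
      (∀ p u v, p ≠ x → IsParent G p u → IsParent G p v → u ≠ v → c u ≠ c v) ∧
      ∀ v ∉ P, c v = red → Set.InjOn c (G.neighborSet v) ∧ (G.neighborSet v).ncard = Δ ∧
        ∀ u, G.Adj v u → u ∈ P ∨ u < v := by
  let sib : V → Set V := fun v => {w | w ≠ v ∧ ∃ p, IsParent G p v ∧ IsParent G p w}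
  have hsibcard : ∀ v ∉ P, (sib v).Finite ∧ (sib v).ncard + 2 ≤ Δ := by
    intro v hv
    obtain ⟨p, hp⟩ := exists_isParent hG hlt (v := v) fun h => hv (h ▸ hxP)
    have hpx : p ≠ x := fun h => hv (hNP (h ▸ hp.1))
    have hS : sib v = {w | w ≠ v ∧ IsParent G p w} := by
      ext w
      constructor
      · rintro ⟨hw, q, hq, hqw⟩
        exact ⟨hw, hp.unique hq ▸ hqw⟩
      · rintro ⟨hw, hpw⟩
        exact ⟨hw, p, hp, hpw⟩
    rw [hS]
    exact ncard_siblings_add_two_le hG hdeg hlt hpx hp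
  obtain ⟨c, hc₀, hc⟩ := exists_greedy_extension (fun v => G.neighborSet v ∪ sib v) P c₀ red
    (by
      intro v hv
      obtain ⟨h1, h2⟩ := hsibcard v hv
      refine ⟨(hdeg v).1.union h1, ?_⟩
      have := Set.ncard_union_le (G.neighborSet v) (sib v)
      have := (hdeg v).2
      omega)
  have hdiff : ∀ u v, u ≠ v → (u ∈ P → v ∈ P → c₀ u ≠ c₀ v) →
      u ∈ G.neighborSet v ∪ sib v → v ∈ G.neighborSet u ∪ sib u → c u ≠ c v := by
    intro u v huv hP hu hv
    by_cases huP : u ∈ P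
    · by_cases hvP : v ∈ P
      · rw [hc₀ huP, hc₀ hvP]
        exact hP huP hvP
      · exact ((hc v hvP).1 u hu (Or.inl huP)).symm
    · by_cases hvP : v ∈ P
      · exact (hc u huP).1 v hv (Or.inl hvP)
      · rcases lt_or_gt_of_ne huv with h | h
        · exact ((hc v hvP).1 u hu (Or.inr h)).symm
        · exact (hc u huP).1 v hv (Or.inr h)
  refine ⟨c, hc₀, fun u v huv => ?_, fun p u v hpx hpu hpv huv => ?_, fun v hv hred => ?_⟩
  · exact hdiff u v huv.ne (fun hu hv => hproper u hu v hv huv) (Or.inl huv.symm) (Or.inl huv)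
  · exact hdiff u v huv (fun hu hv => hsib p u v hpx hu hv hpu hpv huv)
      (Or.inr ⟨huv, p, hpv, hpu⟩) (Or.inr ⟨huv.symm, p, hpu, hpv⟩)
  · set A : Set V := {u | G.Adj v u ∧ (u ∈ P ∨ u < v)}
    have hAN : A ⊆ G.neighborSet v := fun u hu => hu.1
    have hAfin : A.Finite := (hdeg v).1.subset hAN
    have hsub : ({red}ᶜ : Set α) ⊆ c '' A ∪ c '' sib v := by
      intro a ha
      obtain ⟨u, hu | hu, hu', rfl⟩ := (hc v hv).2 hred a ha
      · exact Or.inl ⟨u, ⟨hu, hu'⟩, rfl⟩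
      · exact Or.inr ⟨u, hu, rfl⟩
    obtain ⟨hsfin, hscard⟩ := hsibcard v hv
    have h1 := Set.ncard_le_ncard hsub (Set.toFinite _)
    have h2 := Set.ncard_union_le (c '' A) (c '' sib v)
    have h3 := Set.ncard_image_le (f := c) hsfin
    have h4 := Set.ncard_image_le (f := c) hAfin
    have h5 := Set.ncard_le_ncard hAN (hdeg v).1
    have h6 := (hdeg v).2
    have h7 := Set.ncard_add_ncard_compl ({red} : Set α)
    rw [Set.ncard_singleton] at h7
    have hA : A = G.neighborSet v := Set.eq_of_subset_of_ncard_le hAN (by omega) (hdeg v).1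
    refine ⟨?_, by omega, fun u hu => ?_⟩
    · rw [← hA]
      exact Set.injOn_of_ncard_image_eq (by omega) hAfin
    · have hu' : u ∈ A := hA ▸ hu
      exact hu'.2

/-- An automorphism preserving a colouring in which siblings away from the root have different
colours is the identity as soon as it fixes the closed neighbourhood of the root. -/
theorem apply_eq_self_of_fixes_neighborSet {V α : Type*} [LinearOrder V] [WellFoundedLT V]
    {G : SimpleGraph V} (hG : G.Connected) {x : V}
    (hlt : ∀ u v : V, G.dist x u < G.dist x v → u < v) {c : V → α}
    (hsib : ∀ p u v, p ≠ x → IsParent G p u → IsParent G p v → u ≠ v → c u ≠ c v)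
    {φ : G ≃g G} (hφ : ∀ v, c (φ v) = c v) (hx : φ x = x) (hN : ∀ v, G.Adj x v → φ v = v)
    (v : V) : φ v = v := by
  have key : ∀ p v, IsParent G p v → φ v = v := by
    intro p
    induction p using WellFoundedLT.induction with
    | ind p ih =>
      intro v hv
      by_cases hpx : p = x
      · exact hN v (hpx ▸ hv.1)
      obtain ⟨q, hq⟩ := exists_isParent hG hlt hpx
      have hp : φ p = p := ih q hq.2.1 p hq
      have hadj : G.Adj p (φ v) := by
        have := φ.map_rel_iff.2 hv.1
        rwa [hp] at this
      by_cases hvx : φ v = x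
      · exact φ.injective (hvx.trans hx.symm) ▸ hx
      obtain ⟨r, hr⟩ := exists_isParent hG hlt hvx
      rcases lt_or_eq_of_le (hr.2.2 p hadj) with h | rfl
      · exact φ.injective (ih r h _ hr)
      · by_contra hne
        exact hsib _ _ _ hpx hr hv hne (hφ v)
  by_cases hvx : v = x
  · rw [hvx, hx]
  · obtain ⟨p, hp⟩ := exists_isParent hG hlt hvx
    exact key p v hp

/-- A finite set can be coloured injectively without the colour `red` if there are enough
colours. -/
theorem exists_injOn_ne {V α : Type*} [Finite α] (red : α) {s : Set V} (hs : s.Finite)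
    (hcard : s.ncard + 1 ≤ Nat.card α) : ∃ g : V → α, Set.InjOn g s ∧ ∀ v ∈ s, g v ≠ red := by
  have : Nonempty α := ⟨red⟩
  have h := Set.ncard_add_ncard_compl ({red} : Set α)
  rw [Set.ncard_singleton] at h
  obtain ⟨g, hg, hinj⟩ := hs.exists_injOn_of_encard_le (t := ({red}ᶜ : Set α)) (by
    rw [← hs.cast_ncard_eq, ← (Set.toFinite ({red}ᶜ : Set α)).cast_ncard_eq]
    exact_mod_cast (by omega : s.ncard ≤ ({red}ᶜ : Set α).ncard))
  exact ⟨g, hinj, fun v hv => hg hv⟩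

theorem ncard_neighborSet_apply {V : Type*} {G : SimpleGraph V} (φ : G ≃g G) (v : V) :
    (G.neighborSet (φ v)).ncard = (G.neighborSet v).ncard := by
  have h : G.neighborSet (φ v) = φ '' G.neighborSet v := by
    ext w
    constructor
    · intro hw
      refine ⟨φ.symm w, φ.map_rel_iff.1 ?_, φ.apply_symm_apply w⟩
      rw [φ.apply_symm_apply]
      exact hw
    · rintro ⟨u, hu, rfl⟩
      exact φ.map_rel_iff.2 hu
  rw [h, Set.ncard_image_of_injective _ φ.injective]

theorem dist_le_dist_of_mem_insert_neighborSet {V : Type*} {G : SimpleGraph V} (hG : G.Connected) {x u v : V}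
    (hv : v ≠ x) (hu : u ∈ insert x (G.neighborSet x)) : G.dist x u ≤ G.dist x v := by
  rcases hu with rfl | hu
  · simp
  · rw [dist_eq_one_iff_adj.2 hu]
    exact hG.pos_dist_of_ne hv.symm

/-- A proper distinguishing colouring exists if some root has the following property: every
vertex outside its closed neighbourhood that has full degree and no neighbour farther from the
root has a degree different from the degree of the root. -/
theorem exists_coloring_of_root {V α : Type*} [Finite α] {G : SimpleGraph V}
    (hG : G.Connected) {Δ : ℕ} (hΔ : 2 ≤ Δ)
    (hdeg : ∀ v, (G.neighborSet v).Finite ∧ (G.neighborSet v).ncard ≤ Δ)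
    (hα : Nat.card α + 1 = 2 * Δ) (x : V)
    (hx : ∀ v, v ≠ x → (∀ u, G.Adj v u → G.dist x u ≤ G.dist x v) →
      (G.neighborSet v).ncard = Δ → (G.neighborSet x).ncard ≠ Δ) :
    ∃ c : V → α, IsProperVertexColoring G c ∧ IsDistinguishingVertexColoring G c := by
  classical
  obtain ⟨_, _, hlt⟩ := exists_wellOrder_of_dist G x
  have : Nonempty α := (Nat.card_pos_iff.1 (by omega)).1
  obtain ⟨red⟩ := this
  obtain ⟨g, hginj, hgred⟩ := exists_injOn_ne red (hdeg x).1 (by have := (hdeg x).2; omega)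
  set P : Set V := insert x (G.neighborSet x)
  obtain ⟨c, hcP, hproper, hsib, hred⟩ := exists_coloring_extension hG hdeg hlt hα red P
    (Or.inl rfl) (fun _ h => Or.inr h) (Function.update g x red)
    (by
      have hN : ∀ v, G.Adj x v → Function.update g x red v = g v := fun v hv =>
        Function.update_of_ne hv.ne' _ _
      rintro u (rfl | hu) v (rfl | hv) huv
      · exact absurd rfl huv.ne
      · rw [Function.update_self, hN v hv]
        exact (hgred v hv).symm
      · rw [Function.update_self, hN u hu]
        exact hgred u hu
      · rw [hN u hu, hN v hv]
        exact fun h => huv.ne (hginj hu hv h))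
    (by
      rintro p u v hp (rfl | hu) hv hpu hpv huv
      · obtain ⟨q, hq⟩ := exists_isParent hG hlt hp
        have := hpu.2.1
        have h0 := hlt u p (by simpa using hG.pos_dist_of_ne hp.symm)
        exact absurd this (lt_asymm h0)
      · have h1 := hpu.2.2 x hu
        have h0 := hlt x p (by simpa using hG.pos_dist_of_ne hp.symm)
        exact absurd h1 (not_le.2 h0))
  have hcx : c x = red := by rw [hcP (Or.inl rfl), Function.update_self]
  have hcN : ∀ v, G.Adj x v → c v = g v := fun v hv => by
    rw [hcP (Or.inr hv), Function.update_of_ne hv.ne']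
  refine ⟨c, hproper, fun φ hφ => ?_⟩
  have hφx : φ x = x := by
    by_contra hne
    by_cases hmem : φ x ∈ P
    · rcases hmem with h | h
      · exact hne h
      · exact hgred _ h (by rw [← hcN _ h, hφ, hcx])
    · obtain ⟨-, hdegφ, hearly⟩ := hred (φ x) hmem ((hφ x).trans hcx)
      refine hx (φ x) hne (fun u hu => ?_) hdegφ (by rw [← ncard_neighborSet_apply φ, hdegφ])
      rcases hearly u hu with h | h
      · exact dist_le_dist_of_mem_insert_neighborSet hG hne h
      · exact not_lt.1 fun h' => lt_asymm h (hlt _ _ h')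
  refine apply_eq_self_of_fixes_neighborSet hG hlt hsib hφ hφx fun v hv => ?_
  have hv' : G.Adj x (φ v) := by
    have := φ.map_rel_iff.2 hv
    rwa [hφx] at this
  exact hginj hv' hv (by rw [← hcN _ hv', ← hcN _ hv, hφ])

/-- In a tree, every vertex has at most one neighbour that is not farther from the root. -/
theorem SimpleGraph.IsTree.eq_of_adj_of_dist_le {V : Type*} {G : SimpleGraph V} (hG : G.IsTree)
    {x v u w : V} (hu : G.Adj v u) (hw : G.Adj v w) (hdu : G.dist x u ≤ G.dist x v)
    (hdw : G.dist x w ≤ G.dist x v) : u = w := by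
  obtain ⟨p, hp, -⟩ := hG.connected.exists_path_of_dist x v
  have key : ∀ u, G.Adj v u → G.dist x u ≤ G.dist x v → u = p.penultimate := by
    intro u hu hd
    obtain ⟨q, hq, hql⟩ := hG.connected.exists_path_of_dist x u
    refine hG.isAcyclic.eq_penultimate_of_adj_end hp hu ?_
    refine hG.isAcyclic.mem_support_of_ne_mem_support_of_adj_of_isPath hp hq hu fun hv => ?_
    have h1 := hG.dist_ne_of_adj x hu
    classical
    have h2 := dist_le (q.takeUntil v hv)
    have h3 := q.length_takeUntil_le_length hv
    omega
  rw [key u hu hdu, key w hw hdw]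

/-- An infinite connected graph that is regular of degree two is a tree. -/
theorem isTree_of_ncard_neighborSet_eq_two {V : Type*} [Infinite V] {G : SimpleGraph V}
    (hG : G.Connected) (hdeg : ∀ v, (G.neighborSet v).ncard = 2) : G.IsTree := by
  refine ⟨hG, fun o p hp => ?_⟩
  have hfin : {v | v ∈ p.support}.Finite := p.support.finite_toSet
  refine Set.infinite_univ (hfin.subset fun v _ => ?_)
  refine mem_of_closed_of_connected hG (o := o) p.start_mem_support (fun u v hu huv => ?_) v
  have hN : p.toSubgraph.neighborSet u = G.neighborSet u :=
    Set.eq_of_subset_of_ncard_le (p.toSubgraph.neighborSet_subset u)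
      (by rw [hdeg, hp.ncard_neighborSet_toSubgraph_eq_two hu])
      (Set.finite_of_ncard_pos (by rw [hdeg]; omega))
  have hv : v ∈ p.toSubgraph.neighborSet u := hN ▸ huv
  exact p.mem_verts_toSubgraph.1 hv.snd_mem

/-- An infinite connected locally finite graph is not complete multipartite: some vertex has two
nonadjacent neighbours with different neighbourhoods. -/
theorem exists_not_adj_neighborSet_ne {V : Type*} [Infinite V] {G : SimpleGraph V}
    (hG : G.Connected) (hfin : ∀ v, (G.neighborSet v).Finite) :
    ∃ x y₁ y₂, G.Adj x y₁ ∧ G.Adj x y₂ ∧ y₁ ≠ y₂ ∧ ¬ G.Adj y₁ y₂ ∧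
      G.neighborSet y₁ ≠ G.neighborSet y₂ := by
  by_contra! hcon
  obtain ⟨o⟩ := hG.nonempty
  have hclosed := mem_of_closed_of_connected hG (o := o)
    (S := {v | G.Adj o v ∨ G.neighborSet v = G.neighborSet o}) (Or.inr rfl) (by
      rintro u v (hu | hu) huv
      · by_cases hvo : v = o
        · exact Or.inr (hvo ▸ rfl)
        by_cases hadj : G.Adj o v
        · exact Or.inl hadj
        · exact Or.inr (hcon u v o huv hu.symm hvo fun h => hadj h.symm)
      · have hv : v ∈ G.neighborSet o := hu ▸ huv
        exact Or.inl hv)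
  have : Nontrivial V := inferInstance
  obtain ⟨w, hw⟩ := hG.preconnected.exists_adj_of_nontrivial o
  refine Set.infinite_univ (((hfin o).union (hfin w)).subset fun v _ => ?_)
  rcases hclosed v with h | h
  · exact Or.inl h
  · have hv : w ∈ G.neighborSet v := by
      rw [h]
      exact hw
    exact Or.inr (G.adj_symm hv)

/-- A partial colouring around a root `x` with two neighbours `y₁` and `y₂` of the same colour:
`red` appears only at the root, and the vertices at distance two from `x` that are equal to `z`
or adjacent to `y₂` receive different colours. -/
theorem exists_precoloring {V α : Type*} [Finite α] {G : SimpleGraph V} {Δ : ℕ} (hΔ : 3 ≤ Δ)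
    (hdeg : ∀ v, (G.neighborSet v).Finite ∧ (G.neighborSet v).ncard = Δ)
    (hα : Nat.card α + 1 = 2 * Δ) (red : α) {x y₁ y₂ : V} (z : V) (h₁ : G.Adj x y₁)
    (h₂ : G.Adj x y₂) (hne : y₁ ≠ y₂) :
    ∃ c : V → α, c x = red ∧ (∀ u, u ≠ x → c u ≠ red) ∧
      Set.InjOn c (G.neighborSet x \ {y₂}) ∧ c y₂ = c y₁ ∧
      Set.InjOn c (insert z (G.neighborSet y₂) \ insert x (G.neighborSet x)) ∧
      ∀ m ∈ insert z (G.neighborSet y₂) \ insert x (G.neighborSet x), ∀ u, G.Adj x u →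
        G.Adj m u → c m ≠ c u := by
  classical
  set M := insert z (G.neighborSet y₂) \ insert x (G.neighborSet x)
  have hMfin : M.Finite := ((hdeg y₂).1.insert z).sdiff
  have hxM : x ∉ M := fun h => h.2 (Or.inl rfl)
  have hMN : ∀ m ∈ M, ¬ G.Adj x m := fun m hm h => hm.2 (Or.inr h)
  obtain ⟨y₃, hy₃, hy₃'⟩ : ∃ y₃ ∈ G.neighborSet x, y₃ ∉ ({y₁, y₂} : Set V) := by
    refine Set.exists_mem_notMem_of_ncard_lt_ncard ?_
    rw [Set.ncard_pair hne, (hdeg x).2]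
    omega
  have h₃₁ : y₃ ≠ y₁ := fun h => hy₃' (Or.inl h)
  have h₃₂ : y₃ ≠ y₂ := fun h => hy₃' (Or.inr h)
  obtain ⟨M', hM'M, hM'card, hM'⟩ : ∃ M' ⊆ M, M'.ncard + 1 ≤ Δ ∧
      ∀ s ∈ M \ M', ¬ G.Adj s y₃ ∧ ∀ t ∈ M \ M', s = t := by
    by_cases h : ∃ s ∈ M, ¬ G.Adj s y₃
    · obtain ⟨s, hs, hs₃⟩ := h
      refine ⟨M \ {s}, Set.sdiff_subset, ?_, ?_⟩
      · rw [Set.ncard_sdiff_singleton_add_one hs hMfin]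
        have hsub : M ⊆ insert z (G.neighborSet y₂ \ {x}) := by
          rintro m ⟨rfl | hm, hm'⟩
          · exact Or.inl rfl
          · exact Or.inr ⟨hm, fun h => hm' (Or.inl h)⟩
        have h1 := Set.ncard_le_ncard hsub ((hdeg y₂).1.sdiff.insert z)
        have h2 := Set.ncard_insert_le z (G.neighborSet y₂ \ {x})
        have h3 := Set.ncard_sdiff_singleton_add_one
          (show x ∈ G.neighborSet y₂ from h₂.symm) (hdeg y₂).1
        have h4 := (hdeg y₂).2
        omega
      · have hall : ∀ t ∈ M \ (M \ {s}), t = s := fun t ht => by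
          by_contra hts
          exact ht.2 ⟨ht.1, hts⟩
        exact fun t ht => ⟨hall t ht ▸ hs₃, fun u hu => (hall t ht).trans (hall u hu).symm⟩
    · push Not at h
      refine ⟨M, subset_rfl, ?_, fun s hs => absurd hs.1 hs.2⟩
      have hsub : insert x M ⊆ G.neighborSet y₃ := by
        rintro m (rfl | hm)
        · exact G.adj_symm hy₃
        · exact (h m hm).symm
      have h1 := Set.ncard_le_ncard hsub (hdeg y₃).1
      rwa [Set.ncard_insert_of_notMem hxM hMfin, (hdeg y₃).2] at h1
  set A := (G.neighborSet x \ {y₂}) ∪ M'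
  obtain ⟨g, hg, hgred⟩ := exists_injOn_ne red
    (((hdeg x).1.sdiff (t := {y₂})).union (hMfin.subset hM'M)) (by
      have h1 := Set.ncard_union_le (G.neighborSet x \ {y₂}) M'
      have h2 := Set.ncard_sdiff_singleton_add_one
        (show y₂ ∈ G.neighborSet x from h₂) (hdeg x).1
      have h3 := (hdeg x).2
      omega)
  have hNA : ∀ u, G.Adj x u → u ≠ y₂ → u ∈ A := fun u hu hu' => Or.inl ⟨hu, hu'⟩
  let c : V → α := fun v =>
    if v = x then red else if v = y₂ then g y₁ else if v ∈ A then g v else g y₃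
  have hcN : ∀ u, G.Adj x u → u ≠ y₂ → c u = g u := fun u hu hu' => by
    simp only [c, if_neg hu.ne', if_neg hu', if_pos (hNA u hu hu')]
  have hcy₂ : c y₂ = g y₁ := by simp [c, h₂.ne']
  have hcM' : ∀ m ∈ M', c m = g m := fun m hm => by
    have h1 : m ≠ x := fun h => hxM (h ▸ hM'M hm)
    have h2 : m ≠ y₂ := fun h => hMN m (hM'M hm) (h ▸ h₂)
    have h3 : m ∈ A := Or.inr hm
    simp only [c, if_neg h1, if_neg h2, if_pos h3]
  have hcM : ∀ m ∈ M, m ∉ M' → c m = g y₃ := fun m hm hm' => by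
    have h1 : m ≠ x := fun h => hxM (h ▸ hm)
    have h2 : m ≠ y₂ := fun h => hMN m hm (h ▸ h₂)
    have h3 : m ∉ A := fun h => h.elim (fun h => hMN m hm h.1) hm'
    simp only [c, if_neg h1, if_neg h2, if_neg h3]
  have hgM' : ∀ m ∈ M', ∀ u, G.Adj x u → u ≠ y₂ → g m ≠ g u := fun m hm u hu hu' h =>
    hMN m (hM'M hm) (hg (Or.inr hm) (hNA u hu hu') h ▸ hu)
  refine ⟨c, by simp [c], fun u hu => ?_, ?_, ?_, ?_, ?_⟩
  · simp only [c, if_neg hu]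
    split_ifs with h h'
    · exact hgred _ (hNA y₁ h₁ hne)
    · exact hgred _ h'
    · exact hgred _ (hNA y₃ hy₃ h₃₂)
  · intro u hu v hv huv
    rw [hcN u hu.1 hu.2, hcN v hv.1 hv.2] at huv
    exact hg (Or.inl hu) (Or.inl hv) huv
  · rw [hcy₂, hcN y₁ h₁ hne]
  · intro u hu v hv huv
    by_cases hu' : u ∈ M' <;> by_cases hv' : v ∈ M'
    · rw [hcM' u hu', hcM' v hv'] at huv
      exact hg (Or.inr hu') (Or.inr hv') huv
    · rw [hcM' u hu', hcM v hv hv'] at huv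
      exact absurd huv (hgM' u hu' y₃ hy₃ h₃₂)
    · rw [hcM u hu hu', hcM' v hv'] at huv
      exact absurd huv.symm (hgM' v hv' y₃ hy₃ h₃₂)
    · exact (hM' u ⟨hu, hu'⟩).2 v ⟨hv, hv'⟩
  · intro m hm u hu hmu
    obtain ⟨u', hu', hu'₂, hcu, hu'₃⟩ :
        ∃ u', G.Adj x u' ∧ u' ≠ y₂ ∧ c u = g u' ∧ (u' = y₃ → u = y₃) := by
      by_cases h : u = y₂
      · exact ⟨y₁, h₁, hne, h ▸ hcy₂, fun h' => absurd h'.symm h₃₁⟩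
      · exact ⟨u, hu, h, hcN u hu h, id⟩
    rw [hcu]
    by_cases hm' : m ∈ M'
    · rw [hcM' m hm']
      exact hgM' m hm' u' hu' hu'₂
    · rw [hcM m hm hm']
      intro h
      have h3 := hg (hNA y₃ hy₃ h₃₂) (hNA u' hu' hu'₂) h
      exact (hM' m ⟨hm, hm'⟩).1 (hu'₃ h3.symm ▸ hmu)

/-- A proper distinguishing colouring with `2 * Δ - 1` colours exists for infinite connected
`Δ`-regular graphs with `Δ ≥ 3`. -/
theorem exists_coloring_of_regular {V α : Type*} [Infinite V] [Finite α] {G : SimpleGraph V}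
    (hG : G.Connected) {Δ : ℕ} (hΔ : 3 ≤ Δ)
    (hdeg : ∀ v, (G.neighborSet v).Finite ∧ (G.neighborSet v).ncard = Δ)
    (hα : Nat.card α + 1 = 2 * Δ) :
    ∃ c : V → α, IsProperVertexColoring G c ∧ IsDistinguishingVertexColoring G c := by
  have : Nonempty α := (Nat.card_pos_iff.1 (by omega)).1
  obtain ⟨red⟩ := this
  obtain ⟨x, y₁, y₂, h₁, h₂, hne, hnadj, hN⟩ :=
    exists_not_adj_neighborSet_ne hG fun v => (hdeg v).1
  obtain ⟨z, hz₁, hz₂⟩ : ∃ z, G.Adj y₁ z ∧ ¬ G.Adj y₂ z := by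
    by_contra! h
    exact hN (Set.eq_of_subset_of_ncard_le (fun z hz => h z hz)
      (by rw [(hdeg y₁).2, (hdeg y₂).2]) (hdeg y₂).1)
  obtain ⟨_, _, hlt⟩ := exists_wellOrder_of_dist G x
  obtain ⟨c₀, hx, hred₀, hinjN, hy, hinjM, hMN⟩ :=
    exists_precoloring hΔ hdeg hα red z h₁ h₂ hne
  set M := insert z (G.neighborSet y₂) \ insert x (G.neighborSet x)
  set P := insert x (G.neighborSet x) ∪ M
  have hcase : ∀ u ∈ P, u = x ∨ G.Adj x u ∨ u ∈ M := by
    rintro u ((h | h) | h)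
    · exact Or.inl h
    · exact Or.inr (Or.inl h)
    · exact Or.inr (Or.inr h)
  have hsame : ∀ u v, G.Adj x u → G.Adj x v → c₀ u = c₀ v →
      u = v ∨ (u = y₁ ∧ v = y₂) ∨ (u = y₂ ∧ v = y₁) := by
    intro u v hu hv huv
    by_cases hu₂ : u = y₂ <;> by_cases hv₂ : v = y₂
    · exact Or.inl (hu₂.trans hv₂.symm)
    · refine Or.inr (Or.inr ⟨hu₂, hinjN ⟨hv, hv₂⟩ ⟨h₁, hne⟩ ?_⟩)
      rw [← huv, hu₂, hy]
    · refine Or.inr (Or.inl ⟨hinjN ⟨hu, hu₂⟩ ⟨h₁, hne⟩ ?_, hv₂⟩)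
      rw [huv, hv₂, hy]
    · exact Or.inl (hinjN ⟨hu, hu₂⟩ ⟨hv, hv₂⟩ huv)
  obtain ⟨c, hcP, hproper, hsib, hred⟩ := exists_coloring_extension hG
    (fun v => ⟨(hdeg v).1, (hdeg v).2.le⟩) hlt hα red P
    (Or.inl (Or.inl rfl)) (fun _ h => Or.inl (Or.inr h)) c₀
    (by
      intro u hu v hv huv
      rcases hcase u hu with rfl | hu' | hu' <;> rcases hcase v hv with rfl | hv' | hv'
      · exact absurd rfl huv.ne
      · rw [hx]
        exact (hred₀ v huv.ne').symm
      · rw [hx]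
        exact (hred₀ v huv.ne').symm
      · rw [hx]
        exact hred₀ u huv.ne
      · intro h
        rcases hsame u v hu' hv' h with h | ⟨rfl, rfl⟩ | ⟨rfl, rfl⟩
        · exact huv.ne h
        · exact hnadj huv
        · exact hnadj huv.symm
      · exact (hMN v hv' u hu' huv.symm).symm
      · rw [hx]
        exact hred₀ u huv.ne
      · exact hMN u hu' v hv' huv
      · exact fun h => huv.ne (hinjM hu' hv' h))
    (by
      intro p u v hp hu hv hpu hpv huv
      have h0 : x < p := hlt x p (by simpa using hG.pos_dist_of_ne hp.symm)
      have hmem : ∀ w ∈ P, IsParent G p w → w ∈ M := by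
        intro w hw hpw
        rcases hcase w hw with rfl | h | h
        · exact absurd hpw.2.1 (lt_asymm h0)
        · exact absurd (hpw.2.2 x h) (not_le.2 h0)
        · exact h
      exact fun h => huv (hinjM (hmem u hu hpu) (hmem v hv hpv) h))
  have hcN : ∀ v, G.Adj x v → c v = c₀ v := fun v hv => hcP (Or.inl (Or.inr hv))
  refine ⟨c, hproper, fun φ hφ => ?_⟩
  have hcx : c x = red := by rw [hcP (Or.inl (Or.inl rfl)), hx]
  have hφx : φ x = x := by
    by_contra hφne
    have hcφ : c (φ x) = red := (hφ x).trans hcx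
    by_cases hmem : φ x ∈ P
    · exact hred₀ _ hφne (by rw [← hcP hmem, hcφ])
    · refine hne (φ.injective ((hred (φ x) hmem hcφ).1 (φ.map_rel_iff.2 h₁)
        (φ.map_rel_iff.2 h₂) ?_))
      rw [hφ, hφ, hcN y₁ h₁, hcN y₂ h₂, hy]
  have hφadj : ∀ v, G.Adj x (φ v) ↔ G.Adj x v := fun v => by
    have := φ.map_rel_iff (a := x) (b := v)
    rwa [hφx] at this
  have hφN : ∀ v, G.Adj x v → φ v = v ∨ (φ v = y₁ ∧ v = y₂) ∨ (φ v = y₂ ∧ v = y₁) := by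
    intro v hv
    have hv' := (hφadj v).2 hv
    exact hsame _ _ hv' hv (by rw [← hcN _ hv', ← hcN _ hv, hφ])
  have hφy₁ : φ y₁ ≠ y₂ := by
    intro hswap
    have hφz : G.Adj y₂ (φ z) := by
      have := φ.map_rel_iff.2 hz₁
      rwa [hswap] at this
    have hzx : z ≠ x := fun h => hz₂ (h ▸ h₂.symm)
    by_cases hxz : G.Adj x z
    · rcases hφN z hxz with h | ⟨-, rfl⟩ | ⟨-, rfl⟩
      · exact hz₂ (h ▸ hφz)
      · exact hnadj hz₁
      · exact hz₁.ne rfl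
    · have hzM : z ∈ M := ⟨Or.inl rfl, fun h => h.elim hzx hxz⟩
      have hφzM : φ z ∈ M := by
        refine ⟨Or.inr hφz, fun h => h.elim (fun h => ?_) fun h => hxz ((hφadj z).1 h)⟩
        exact hzx (φ.injective (h.trans hφx.symm))
      have h := hinjM hφzM hzM (by rw [← hcP (Or.inr hφzM), ← hcP (Or.inr hzM), hφ])
      exact hz₂ (h ▸ hφz)
  refine apply_eq_self_of_fixes_neighborSet hG hlt hsib hφ hφx fun v hv => ?_
  rcases hφN v hv with h | ⟨h, rfl⟩ | ⟨h, rfl⟩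
  · exact h
  · rcases hφN y₁ h₁ with h' | ⟨-, h'⟩ | ⟨h', -⟩
    · exact absurd (φ.injective (h'.trans h.symm)) hne
    · exact absurd h' hne
    · exact absurd h' hφy₁
  · exact absurd h hφy₁

/-- In an infinite connected locally finite graph, some vertex has degree at least two. -/
theorem two_le_of_ncard_neighborSet_le {V : Type*} [Infinite V] {G : SimpleGraph V}
    (hG : G.Connected) {Δ : ℕ}
    (hdeg : ∀ v, (G.neighborSet v).Finite ∧ (G.neighborSet v).ncard ≤ Δ) : 2 ≤ Δ := by
  by_contra! hΔ
  obtain ⟨o⟩ := hG.nonempty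
  refine Set.infinite_univ (((hdeg o).1.insert o).subset fun v _ => ?_)
  refine mem_of_closed_of_connected hG (o := o) (Or.inl rfl) ?_ v
  rintro u w (rfl | hu) huw
  · exact Or.inr huw
  · have h := (Set.ncard_le_one (hdeg u).1).1 (by have := (hdeg u).2; omega)
    exact Or.inl (h w huw o (G.adj_symm hu))

/-- A connected infinite graph with finite maximum degree `Δ` admits a proper
distinguishing vertex colouring with `2Δ - 1` colours; i.e. `χ_D(G) ≤ 2Δ - 1`. -/
theorem distinguishingChromaticNumber_le_two_maxDegree_sub_one
    {V : Type*} [Infinite V] (G : SimpleGraph V) (hG : G.Connected) (Δ : ℕ)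
    (hdeg : ∀ v, (G.neighborSet v).Finite ∧ (G.neighborSet v).ncard ≤ Δ)
    (hmax : ∃ v, (G.neighborSet v).ncard = Δ) :
    ∃ c : V → Fin (2 * Δ - 1),
      IsProperVertexColoring G c ∧ IsDistinguishingVertexColoring G c := by
  have hΔ := two_le_of_ncard_neighborSet_le hG hdeg
  have hα : Nat.card (Fin (2 * Δ - 1)) + 1 = 2 * Δ := by
    rw [Nat.card_fin]
    omega
  by_cases hreg : ∀ v, (G.neighborSet v).ncard = Δ
  · rcases hΔ.eq_or_lt with rfl | hΔ'
    · have hT := isTree_of_ncard_neighborSet_eq_two hG hreg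
      obtain ⟨x⟩ := hG.nonempty
      refine exists_coloring_of_root hG hΔ hdeg hα x fun v _ hv hv₂ => ?_
      obtain ⟨a, b, hab, hN⟩ := Set.ncard_eq_two.1 hv₂
      have ha : G.Adj v a := (hN ▸ Or.inl rfl : a ∈ G.neighborSet v)
      have hb : G.Adj v b := (hN ▸ Or.inr rfl : b ∈ G.neighborSet v)
      exact absurd (hT.eq_of_adj_of_dist_le ha hb (hv a ha) (hv b hb)) hab
    · exact exists_coloring_of_regular hG hΔ' (fun v => ⟨(hdeg v).1, hreg v⟩) hα
  · push Not at hreg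
    obtain ⟨x, hx⟩ := hreg
    exact exists_coloring_of_root hG hΔ hdeg hα x fun _ _ _ _ => hx
end

section
/- Let T be an infinite tree (a connected acyclic simple graph with infinitely many vertices) whose maximum degree Δ is finite. Then T admits a proper vertex colouring with Δ + 1 colours that is preserved only by the identity automorphism; that is, χ_D(T) ≤ Δ + 1. -/
open SimpleGraph

open Set

/-- In a tree, a vertex has at most one neighbour that is closer to a given root. -/
theorem SimpleGraph.IsTree.eq_of_adj_of_dist_add_one {V : Type*} {T : SimpleGraph V}
    (hT : T.IsTree) {r u u' v : V} (hu : T.Adj u v) (hu' : T.Adj u' v)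
    (hd : T.dist r v = T.dist r u + 1) (hd' : T.dist r v = T.dist r u' + 1) : u = u' := by
  obtain ⟨p, hp⟩ := hT.connected.exists_walk_length_eq_dist r u
  obtain ⟨q, hq⟩ := hT.connected.exists_walk_length_eq_dist r u'
  have hpath := (p.concat hu).isPath_of_length_eq_dist (by simp [hp, hd])
  have hqath := (q.concat hu').isPath_of_length_eq_dist (by simp [hq, hd'])
  have h := congrArg Walk.penultimate ((hT.existsUnique_path r v).unique hpath hqath)
  simpa using h

/-- In a connected graph, every vertex other than the root has a neighbour that is closer to
the root. -/
theorem SimpleGraph.Connected.exists_adj_dist_add_one {V : Type*} {G : SimpleGraph V}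
    (hG : G.Connected) {r v : V} (hv : v ≠ r) :
    ∃ u, G.Adj u v ∧ G.dist r v = G.dist r u + 1 := by
  obtain ⟨p, hp⟩ := hG.exists_walk_length_eq_dist r v
  have hnil : ¬ p.Nil := fun h => hv h.eq.symm
  refine ⟨p.penultimate, p.adj_penultimate hnil, ?_⟩
  have hadj := p.adj_penultimate hnil
  have h₁ := G.dist_le p.dropLast
  have h₂ : p.dropLast.length + 1 = p.length := by
    rw [← Walk.length_concat p.dropLast hadj, Walk.concat_dropLast hadj]
  have h₃ := hG.dist_triangle (u := r) (v := p.penultimate) (w := v)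
  have h₄ := dist_eq_one_iff_adj.mpr hadj
  omega

/-- The children of `u` when the graph `G` is rooted at `r`. -/
def SimpleGraph.childSet {V : Type*} (G : SimpleGraph V) (r u : V) : Set V :=
  {v | G.Adj u v ∧ G.dist r v = G.dist r u + 1}

/-- In a graph with degrees at most `Δ` rooted at `r`, the children of a vertex `u` can be
coloured injectively while avoiding both the colour `a` of `u` and the colour `Δ`
reserved for the root. -/
theorem SimpleGraph.Connected.exists_injOn_childSet {V : Type*} {G : SimpleGraph V}
    (hG : G.Connected) {Δ : ℕ}
    (hdeg : ∀ v, (G.neighborSet v).Finite ∧ (G.neighborSet v).ncard ≤ Δ)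
    {r u : V} {a : Fin (Δ + 1)} (ha : u = r → a = Fin.last Δ) :
    ∃ f : V → Fin (Δ + 1), (∀ v ∈ G.childSet r u, f v ≠ a ∧ f v ≠ Fin.last Δ) ∧
      InjOn f (G.childSet r u) := by
  obtain ⟨hfin, hcard⟩ := hdeg u
  have hsub : G.childSet r u ⊆ G.neighborSet u := fun v hv => hv.1
  have hfin' := hfin.subset hsub
  have hcompl := ncard_add_ncard_compl ({a, Fin.last Δ} : Set (Fin (Δ + 1)))
  rw [Nat.card_fin] at hcompl
  have hle : (G.childSet r u).ncard ≤ ({a, Fin.last Δ}ᶜ : Set (Fin (Δ + 1))).ncard := by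
    by_cases hu : u = r
    · have h₁ := ncard_le_ncard hsub hfin
      rw [ha hu, pair_eq_singleton, ncard_singleton] at hcompl
      rw [ha hu, pair_eq_singleton]
      omega
    · obtain ⟨w, hwu, hw⟩ := hG.exists_adj_dist_add_one hu
      have hss : G.childSet r u ⊂ G.neighborSet u :=
        (ssubset_iff_of_subset hsub).mpr ⟨w, hwu.symm, fun h => by have := h.2; omega⟩
      have h₁ := ncard_lt_ncard hss hfin
      have h₂ := ncard_insert_le a {Fin.last Δ}
      rw [ncard_singleton] at h₂
      omega
  obtain ⟨f, hf, hinj⟩ := hfin'.exists_injOn_of_encard_le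
    (t := ({a, Fin.last Δ}ᶜ : Set (Fin (Δ + 1))))
    (by rw [← hfin'.cast_ncard_eq, ← (toFinite _).cast_ncard_eq]; exact_mod_cast hle)
  refine ⟨f, fun v hv => ?_, hinj⟩
  have h := hf hv
  simpa [not_or] using h

/-- In a tree with degrees at most `Δ`, there is a colouring in which the colour `Δ` occurs only
at the root, and the children of each vertex get distinct colours, different from that of their
parent. -/
theorem SimpleGraph.IsTree.exists_rooted_coloring {V : Type*} {T : SimpleGraph V}
    (hT : T.IsTree) {Δ : ℕ}
    (hdeg : ∀ v, (T.neighborSet v).Finite ∧ (T.neighborSet v).ncard ≤ Δ) (r : V) :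
    ∃ c : V → Fin (Δ + 1), (∀ v, c v = Fin.last Δ ↔ v = r) ∧
      ∀ u, (∀ v ∈ T.childSet r u, c v ≠ c u) ∧ InjOn c (T.childSet r u) := by
  have hex : ∀ u a, ∃ f : V → Fin (Δ + 1), (u = r → a = Fin.last Δ) →
      (∀ v ∈ T.childSet r u, f v ≠ a ∧ f v ≠ Fin.last Δ) ∧ InjOn f (T.childSet r u) := by
    intro u a
    by_cases ha : u = r → a = Fin.last Δ
    · obtain ⟨f, hf⟩ := hT.connected.exists_injOn_childSet hdeg ha
      exact ⟨f, fun _ => hf⟩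
    · exact ⟨fun _ => a, fun h => absurd h ha⟩
  choose F hF using hex
  have hpar : ∀ v, ∃ u, v ≠ r → v ∈ T.childSet r u := by
    intro v
    by_cases hv : v = r
    · exact ⟨r, fun h => absurd hv h⟩
    · obtain ⟨u, hu⟩ := hT.connected.exists_adj_dist_add_one hv
      exact ⟨u, fun _ => hu⟩
  choose p hp using hpar
  let level : ℕ → V → Fin (Δ + 1) := fun n =>
    Nat.rec (fun _ => Fin.last Δ) (fun _ c v => F (p v) (c (p v)) v) n
  let c : V → Fin (Δ + 1) := fun v => level (T.dist r v) v
  have hroot : c r = Fin.last Δ := by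
    change level (T.dist r r) r = _
    rw [dist_self]
    rfl
  have hchild : ∀ u, ∀ v ∈ T.childSet r u, c v = F u (c u) v := by
    intro u v hv
    have hvr : v ≠ r := by
      rintro rfl
      have := hv.2
      rw [dist_self] at this
      omega
    have hpu : p v = u :=
      hT.eq_of_adj_of_dist_add_one (hp v hvr).1 hv.1 (hp v hvr).2 hv.2
    change level (T.dist r v) v = _
    rw [hv.2]
    change F (p v) (level (T.dist r u) (p v)) v = _
    rw [hpu]
  have hspec := fun u => hF u (c u) (fun h => h ▸ hroot)
  refine ⟨c, fun v => ⟨fun hv => ?_, fun hv => hv ▸ hroot⟩, fun u => ⟨fun v hv => ?_, ?_⟩⟩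
  · by_contra hvr
    exact ((hspec (p v)).1 v (hp v hvr)).2 (hchild _ v (hp v hvr) ▸ hv)
  · rw [hchild u v hv]
    exact ((hspec u).1 v hv).1
  · exact (hspec u).2.congr fun v hv => (hchild u v hv).symm

/-- An infinite tree with finite maximum degree `Δ` admits a proper distinguishing
vertex colouring with `Δ + 1` colours; i.e. `χ_D(T) ≤ Δ + 1`. -/
theorem tree_distinguishingChromaticNumber_le_maxDegree_add_one
    {V : Type*} [Infinite V] (T : SimpleGraph V) (hT : T.IsTree) (Δ : ℕ)
    (hdeg : ∀ v, (T.neighborSet v).Finite ∧ (T.neighborSet v).ncard ≤ Δ)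
    (hmax : ∃ v, (T.neighborSet v).ncard = Δ) :
    ∃ c : V → Fin (Δ + 1),
      IsProperVertexColoring T c ∧ IsDistinguishingVertexColoring T c := by
  obtain ⟨r, -⟩ := hmax
  obtain ⟨c, hroot, hc⟩ := hT.exists_rooted_coloring hdeg r
  refine ⟨c, fun u v huv => ?_, fun φ hφ => ?_⟩
  · rcases hT.dist_eq_dist_add_one_of_adj r huv with h | h
    · exact (hc v).1 u ⟨huv.symm, h⟩
    · exact ((hc u).1 v ⟨huv, h⟩).symm
  · intro v
    induction hn : T.dist r v using Nat.strong_induction_on generalizing v with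
    | _ n ih =>
      by_cases hv : v = r
      · rw [hv]
        exact (hroot _).mp ((hφ r).trans ((hroot r).mpr rfl))
      · obtain ⟨u, huv, hd⟩ := hT.connected.exists_adj_dist_add_one hv
        have hadj : T.Adj u (φ v) := by
          have h := φ.map_adj_iff.mpr huv
          rwa [ih _ (by omega) u rfl] at h
        rcases hT.dist_eq_dist_add_one_of_adj r hadj with h | h
        · exact φ.injective (ih _ (by omega) (φ v) rfl)
        · exact (hc u).2 ⟨hadj, h⟩ ⟨huv, hd⟩ (hφ v)
end

section
/- Let T be an infinite, locally finite tree with infinite motion (every non-identity automorphism of T moves infinitely many vertices). Then T admits a proper vertex colouring with 3 colours that is preserved only by the identity automorphism; that is, χ_D(T) ≤ 3. -/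
open SimpleGraph

namespace SimpleGraph

variable {V : Type*} {G : SimpleGraph V}

lemma Iso.dist_map (φ : G ≃g G) (hG : G.Connected) (u v : V) :
    G.dist (φ u) (φ v) = G.dist u v := by
  have key : ∀ (ψ : G ≃g G) (a b : V), G.dist (ψ a) (ψ b) ≤ G.dist a b := by
    intro ψ a b
    obtain ⟨p, hp⟩ := hG.exists_walk_length_eq_dist a b
    rw [← hp]
    simpa using dist_le (p.map ψ.toHom)
  refine le_antisymm (key φ u v) ?_
  simpa using key φ.symm (φ u) (φ v)

lemma Connected.finite_setOf_dist_le (hG : G.Connected)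
    (hlf : ∀ v, (G.neighborSet v).Finite) (r : V) (n : ℕ) : {v | G.dist r v ≤ n}.Finite := by
  induction n with
  | zero =>
    refine (Set.finite_singleton r).subset fun v hv ↦ ?_
    have : G.dist r v = 0 := Nat.le_zero.1 hv
    exact (hG.dist_eq_zero_iff.1 this).symm
  | succ n ih =>
    refine ((Set.finite_singleton r).union (ih.biUnion fun v _ ↦ hlf v)).subset fun v hv ↦ ?_
    obtain ⟨p, hp⟩ := hG.exists_walk_length_eq_dist v r
    cases p with
    | nil => exact Or.inl rfl
    | @cons _ w _ h q =>
      refine Or.inr (Set.mem_biUnion (x := w) ?_ h.symm)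
      have h1 := dist_le q
      have h2 : G.dist r v ≤ n + 1 := hv
      rw [Walk.length_cons, dist_comm] at hp
      rw [dist_comm] at h1
      change G.dist r w ≤ n
      omega

lemma Connected.countable_of_finite_neighborSet (hG : G.Connected)
    (hlf : ∀ v, (G.neighborSet v).Finite) : Countable V := by
  obtain ⟨r⟩ := hG.nonempty
  rw [← Set.countable_univ_iff]
  refine (Set.countable_iUnion fun n ↦ (hG.finite_setOf_dist_le hlf r n).countable).mono
    fun v _ ↦ Set.mem_iUnion.2 ⟨G.dist r v, ?_⟩
  exact le_refl (G.dist r v)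

/-- The vertices `v` such that `u` lies on a geodesic from `s` to `v`. -/
def branch (G : SimpleGraph V) (s u : V) : Set V :=
  {v | G.dist s u + G.dist u v = G.dist s v}

lemma mem_branch {s u v : V} : v ∈ G.branch s u ↔ G.dist s u + G.dist u v = G.dist s v :=
  Iff.rfl

lemma self_mem_branch (s u : V) : u ∈ G.branch s u := by
  simp [mem_branch]

lemma Iso.map_mem_branch (φ : G ≃g G) (hG : G.Connected) {s u v : V} (hs : φ s = s)
    (hv : v ∈ G.branch s u) : φ v ∈ G.branch s (φ u) := by
  have h1 := φ.dist_map hG s u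
  have h2 := φ.dist_map hG s v
  rw [hs] at h1 h2
  rw [mem_branch, h1, h2, φ.dist_map hG]
  exact hv

lemma IsTree.eq_of_mem_branch (hG : G.IsTree) {s u w v : V} (hu : v ∈ G.branch s u)
    (hw : v ∈ G.branch s w) (h : G.dist s u = G.dist s w) : u = w := by
  obtain ⟨p, hp⟩ := hG.connected.exists_walk_length_eq_dist s u
  obtain ⟨p', hp'⟩ := hG.connected.exists_walk_length_eq_dist u v
  obtain ⟨q, hq⟩ := hG.connected.exists_walk_length_eq_dist s w
  obtain ⟨q', hq'⟩ := hG.connected.exists_walk_length_eq_dist w v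
  rw [mem_branch] at hu hw
  have hpp : (p.append p').IsPath := Walk.isPath_of_length_eq_dist _ (by
    rw [Walk.length_append]; omega)
  have hqq : (q.append q').IsPath := Walk.isPath_of_length_eq_dist _ (by
    rw [Walk.length_append]; omega)
  have heq := (hG.existsUnique_path s v).unique hpp hqq
  have hg := congrArg (fun t ↦ t.getVert (G.dist s u)) heq
  simp only [Walk.getVert_append] at hg
  rw [if_neg (by omega), if_neg (by omega)] at hg
  simpa [hp, hq, h] using hg

lemma IsTree.eq_of_adj_of_dist_add_one_s3 (hG : G.IsTree) {s u w v : V} (huv : G.Adj u v)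
    (hwv : G.Adj w v) (hu : G.dist s u + 1 = G.dist s v) (hw : G.dist s w + 1 = G.dist s v) :
    u = w :=
  hG.eq_of_mem_branch (s := s) (mem_branch.2 (by rw [dist_eq_one_iff_adj.2 huv, hu]))
    (mem_branch.2 (by rw [dist_eq_one_iff_adj.2 hwv, hw])) (by omega)

lemma Connected.exists_adj_dist_add_one_s3 (hG : G.Connected) {u v : V} (h : u ≠ v) :
    ∃ w, G.Adj w v ∧ G.dist u w + 1 = G.dist u v := by
  obtain ⟨p, hp⟩ := hG.exists_walk_length_eq_dist v u
  cases p with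
  | nil => exact absurd rfl h
  | @cons _ w _ hvw q =>
    refine ⟨w, hvw.symm, ?_⟩
    have h1 := dist_le q
    have h2 : G.dist v u ≤ G.dist v w + G.dist w u := hG.dist_triangle
    rw [dist_eq_one_iff_adj.2 hvw] at h2
    rw [Walk.length_cons] at hp
    rw [dist_comm (u := u), dist_comm (u := u)]
    omega

/-- Only the parent of `u` is adjacent to the branch at `u` without belonging to it. -/
lemma IsTree.dist_add_one_of_adj_branch (hG : G.IsTree) {s u a b : V} (hab : G.Adj a b)
    (ha : a ∈ G.branch s u) (hb : b ∉ G.branch s u) : a = u ∧ G.dist s b + 1 = G.dist s u := by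
  have hc := hG.connected
  have htri : G.dist u b ≤ G.dist u a + G.dist a b := hc.dist_triangle
  rw [dist_eq_one_iff_adj.2 hab] at htri
  have htri' : G.dist s b ≤ G.dist s u + G.dist u b := hc.dist_triangle
  rw [mem_branch] at ha hb
  have hsb : G.dist s b + 1 = G.dist s a := by
    rcases hG.dist_eq_dist_add_one_of_adj s hab with h | h <;> omega
  by_cases hau : a = u
  · subst hau
    exact ⟨rfl, hsb⟩
  · exfalso
    obtain ⟨w, hwa, hw⟩ := hc.exists_adj_dist_add_one_s3 (Ne.symm hau)
    have h1 : G.dist s a ≤ G.dist s w + G.dist w a := hc.dist_triangle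
    rw [dist_eq_one_iff_adj.2 hwa] at h1
    have h2 : G.dist s w ≤ G.dist s u + G.dist u w := hc.dist_triangle
    have : w = b := hG.eq_of_adj_of_dist_add_one_s3 (s := s) hwa hab.symm (by omega) hsb
    subst this
    omega

/-- An automorphism may be replaced by the identity outside an invariant set whose outer
boundary it fixes. -/
lemma Iso.exists_eq_on_of_fixed_boundary (φ : G ≃g G) (P : Set V) (hP : ∀ v, φ v ∈ P ↔ v ∈ P)
    (hb : ∀ a b, G.Adj a b → a ∈ P → b ∉ P → φ b = b) :
    ∃ ψ : G ≃g G, (∀ v ∈ P, ψ v = φ v) ∧ ∀ v ∉ P, ψ v = v := by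
  classical
  have hP' : ∀ v, φ.symm v ∈ P ↔ v ∈ P := fun v ↦ by
    rw [← hP, RelIso.apply_symm_apply]
  let e : V ≃ V :=
    { toFun := fun v ↦ if v ∈ P then φ v else v
      invFun := fun v ↦ if v ∈ P then φ.symm v else v
      left_inv := fun v ↦ by by_cases h : v ∈ P <;> simp [h, hP]
      right_inv := fun v ↦ by by_cases h : v ∈ P <;> simp [h, hP'] }
  have he : ∀ v ∈ P, e v = φ v := fun v hv ↦ if_pos hv
  have he' : ∀ v ∉ P, e v = v := fun v hv ↦ if_neg hv
  have hcross : ∀ a b, a ∈ P → b ∉ P → (G.Adj (φ a) b ↔ G.Adj a b) := by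
    intro a b ha hbP
    constructor
    · intro h
      have hfix := hb _ _ h ((hP a).2 ha) hbP
      rw [← hfix] at h
      exact φ.map_adj_iff.1 h
    · intro h
      have hfix := hb _ _ h ha hbP
      rw [← hfix]
      exact φ.map_adj_iff.2 h
  refine ⟨⟨e, ?_⟩, he, he'⟩
  intro a b
  by_cases ha : a ∈ P <;> by_cases hbP : b ∈ P
  · rw [he a ha, he b hbP]
    exact φ.map_adj_iff
  · rw [he a ha, he' b hbP]
    exact hcross a b ha hbP
  · rw [he' a ha, he b hbP, G.adj_comm, G.adj_comm a b]
    exact hcross b a hbP ha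
  · rw [he' a ha, he' b hbP]

/-- With infinite motion, an automorphism fixing a vertex `s` and the root of every infinite
branch seen from `s` is trivial. -/
lemma IsTree.eq_self_of_fixes_infinite_branches (hG : G.IsTree)
    (hlf : ∀ v, (G.neighborSet v).Finite)
    (hmotion : ∀ φ : G ≃g G, (∃ v, φ v ≠ v) → {v | φ v ≠ v}.Infinite)
    (φ : G ≃g G) {s : V} (hs : φ s = s) (hfix : ∀ u, (G.branch s u).Infinite → φ u = u)
    (v : V) : φ v = v := by
  have hc := hG.connected
  have hds : ∀ w, G.dist s (φ w) = G.dist s w := fun w ↦ by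
    have := φ.dist_map hc s w
    rwa [hs] at this
  induction hn : G.dist s v generalizing v with
  | zero =>
    have := hc.dist_eq_zero_iff.1 hn
    subst this
    exact hs
  | succ n ih =>
    by_contra hv
    have hsv : s ≠ v := by
      rintro rfl
      exact hv hs
    obtain ⟨h, hhv, hdist⟩ := hc.exists_adj_dist_add_one_s3 hsv
    have hh : φ h = h := ih h (by omega)
    let U : Set V := {u | G.Adj h u ∧ G.dist s h + 1 = G.dist s u ∧ φ u ≠ u}
    have hU : ∀ u ∈ U, φ u ∈ U := by
      rintro u ⟨h1, h2, h3⟩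
      refine ⟨?_, by rw [hds, h2], fun h4 ↦ h3 (φ.injective h4)⟩
      have := φ.map_adj_iff.2 h1
      rwa [hh] at this
    have hU' : ∀ u ∈ U, φ.symm u ∈ U := by
      rintro u ⟨h1, h2, h3⟩
      have h0 : φ (φ.symm u) = u := φ.apply_symm_apply u
      refine ⟨?_, by rw [← hds (φ.symm u), h0, h2], fun h4 ↦ h3 ?_⟩
      · apply φ.map_adj_iff.1
        rwa [hh, h0]
      · rw [h0] at h4
        conv_lhs => rw [h4]
        exact h0
    have hUfin : U.Finite := (hlf h).subset fun u hu ↦ hu.1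
    let P : Set V := ⋃ u ∈ U, G.branch s u
    have hPfin : P.Finite := hUfin.biUnion fun u hu ↦ by
      by_contra hinf
      exact hu.2.2 (hfix u hinf)
    have hmemP : ∀ w, w ∈ P ↔ ∃ u ∈ U, w ∈ G.branch s u := fun w ↦ by
      simp only [P, Set.mem_iUnion, exists_prop]
    have hsymm : φ.symm s = s := by
      conv_lhs => rw [← hs]
      exact φ.symm_apply_apply s
    have hP : ∀ w, φ w ∈ P ↔ w ∈ P := by
      intro w
      rw [hmemP, hmemP]
      constructor
      · rintro ⟨u, hu, hw⟩
        refine ⟨φ.symm u, hU' u hu, ?_⟩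
        simpa using φ.symm.map_mem_branch hc hsymm hw
      · rintro ⟨u, hu, hw⟩
        exact ⟨φ u, hU u hu, φ.map_mem_branch hc hs hw⟩
    have hb : ∀ a b, G.Adj a b → a ∈ P → b ∉ P → φ b = b := by
      intro a b hab ha hbP
      obtain ⟨u, hu, hau⟩ := (hmemP a).1 ha
      have hbu : b ∉ G.branch s u := fun hbu ↦ hbP ((hmemP b).2 ⟨u, hu, hbu⟩)
      obtain ⟨rfl, hd⟩ := hG.dist_add_one_of_adj_branch hab hau hbu
      have := hG.eq_of_adj_of_dist_add_one_s3 hab.symm hu.1 hd hu.2.1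
      rw [this, hh]
    obtain ⟨ψ, hψ, hψ'⟩ := φ.exists_eq_on_of_fixed_boundary P hP hb
    have hvP : v ∈ P := (hmemP v).2 ⟨v, ⟨hhv, hdist, hv⟩, self_mem_branch s v⟩
    refine hmotion ψ ⟨v, by rwa [hψ v hvP]⟩ (hPfin.subset fun w hw ↦ ?_)
    by_contra hwP
    exact hw (hψ' w hwP)

end SimpleGraph

/-- Countably many infinite sets are all visited cofinally by one sequence along which a
finite-to-one function grows rapidly. -/
lemma exists_seq_frequently_mem_of_infinite {V : Type*} (f : V → ℕ)
    (hf : ∀ n, {v | f v ≤ n}.Finite) (A : ℕ → Set V) (hA : ∀ k, (A k).Infinite) :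
    ∃ x : ℕ → V, (∀ i j, i < j → 3 * f (x i) + 2 < f (x j)) ∧
      ∀ k N, ∃ j ≥ N, x j ∈ A k := by
  have hex : ∀ k n, ∃ v ∈ A k, n < f v := by
    intro k n
    by_contra! h
    exact hA k ((hf n).subset h)
  choose g hgA hgf using hex
  let x : ℕ → V := fun n ↦ Nat.rec (g (Nat.unpair 0).1 0)
    (fun n v ↦ g (Nat.unpair (n + 1)).1 (3 * f v + 2)) n
  have hstep : ∀ n, 3 * f (x n) + 2 < f (x (n + 1)) := fun n ↦ hgf _ _
  have hmem : ∀ n, x n ∈ A (Nat.unpair n).1 := by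
    intro n
    cases n <;> exact hgA _ _
  have hmono : Monotone fun n ↦ f (x n) := monotone_nat_of_le_succ fun n ↦ by
    have := hstep n
    omega
  refine ⟨x, fun i j hij ↦ ?_, fun k N ↦ ⟨Nat.pair k N, Nat.right_le_pair k N, ?_⟩⟩
  · have h1 := hstep i
    have h2 : f (x (i + 1)) ≤ f (x j) := hmono hij
    omega
  · simpa using hmem (Nat.pair k N)

/-- An automorphism permuting the terms of a sufficiently sparse sequence fixes all of them
beyond the first two. -/
lemma SimpleGraph.Iso.apply_seq_eq_of_sparse {V : Type*} {G : SimpleGraph V} (hG : G.Connected)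
    (φ : G ≃g G) (r : V) (x : ℕ → V)
    (hx : ∀ i j, i < j → 3 * G.dist r (x i) + 2 < G.dist r (x j))
    (hφ : ∀ v ∈ Set.range x, φ v ∈ Set.range x) (j : ℕ) (hj : 2 ≤ j) : φ (x j) = x j := by
  have hlt : ∀ i j i' j', i < j → i' < j' → j < j' →
      G.dist (x i) (x j) < G.dist (x i') (x j') := by
    intro i j i' j' hij hij' hjj'
    have h1 : G.dist (x i) (x j) ≤ G.dist (x i) r + G.dist r (x j) := hG.dist_triangle
    have h2 : G.dist r (x j') ≤ G.dist r (x i') + G.dist (x i') (x j') := hG.dist_triangle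
    rw [G.dist_comm (u := x i) (v := r)] at h1
    have h3 := hx _ _ hij
    have h4 := hx _ _ hij'
    have h5 := hx _ _ hjj'
    omega
  have hmax : ∀ i j i' j', i ≠ j → i' ≠ j' → G.dist (x i) (x j) = G.dist (x i') (x j') →
      max i j = max i' j' := by
    intro i j i' j' hij hij' h
    have hnorm : ∀ a b, a ≠ b → min a b < max a b ∧
        G.dist (x (min a b)) (x (max a b)) = G.dist (x a) (x b) := by
      intro a b hab
      rcases lt_or_gt_of_ne hab with h | h
      · simp [h.le, h]
      · simp [h.le, h, G.dist_comm]
    obtain ⟨h1, h2⟩ := hnorm i j hij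
    obtain ⟨h3, h4⟩ := hnorm i' j' hij'
    rcases lt_trichotomy (max i j) (max i' j') with h5 | h5 | h5
    · have := hlt _ _ _ _ h1 h3 h5
      omega
    · exact h5
    · have := hlt _ _ _ _ h3 h1 h5
      omega
  have hσ : ∀ i, ∃ k, x k = φ (x i) := fun i ↦ hφ _ ⟨i, rfl⟩
  choose σ hσ using hσ
  have hxinj : ∀ i j, x i = x j → i = j := by
    intro i j h
    rcases lt_trichotomy i j with h1 | h1 | h1
    · have := hx _ _ h1
      rw [h] at this
      omega
    · exact h1
    · have := hx _ _ h1
      rw [h] at this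
      omega
  have hσinj : ∀ i j, i ≠ j → σ i ≠ σ j := by
    intro i j hij h
    apply hij
    apply hxinj
    apply φ.injective
    rw [← hσ, ← hσ, h]
  have hσmax : ∀ i j, i ≠ j → max (σ i) (σ j) = max i j := by
    intro i j hij
    apply hmax _ _ _ _ (hσinj i j hij) hij
    rw [hσ, hσ, φ.dist_map hG]
  have h0 := hσmax 0 j (by omega)
  have h1 := hσmax 1 j (by omega)
  have h01 := hσinj 0 1 (by omega)
  have : σ j = j := by omega
  rw [← hσ, this]

/-- An infinite, locally finite tree with infinite motion admits a proper distinguishing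
vertex colouring with 3 colours; i.e. `χ_D(T) ≤ 3`. -/
theorem tree_infinite_motion_distinguishingChromaticNumber_le_three
    {V : Type*} [Infinite V] (T : SimpleGraph V) (hT : T.IsTree)
    (hlf : ∀ v, (T.neighborSet v).Finite)
    (hmotion : ∀ φ : T ≃g T, (∃ v, φ v ≠ v) → {v | φ v ≠ v}.Infinite) :
    ∃ c : V → Fin 3,
      IsProperVertexColoring T c ∧ IsDistinguishingVertexColoring T c := by
  classical
  have hc := hT.connected
  obtain ⟨r⟩ := hc.nonempty
  have := hc.countable_of_finite_neighborSet hlf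
  obtain ⟨e, he⟩ := exists_surjective_nat (V × V)
  let A : ℕ → Set V := fun k ↦
    if (T.branch (e k).1 (e k).2).Infinite then T.branch (e k).1 (e k).2 else Set.univ
  have hA : ∀ k, (A k).Infinite := by
    intro k
    by_cases h : (T.branch (e k).1 (e k).2).Infinite
    · simpa only [A, if_pos h] using h
    · simpa only [A, if_neg h] using Set.infinite_univ
  obtain ⟨x, hx, hxA⟩ := exists_seq_frequently_mem_of_infinite (T.dist r)
    (hc.finite_setOf_dist_le hlf r) A hA
  have hindep : ∀ u v, T.Adj u v → u ∈ Set.range x → v ∉ Set.range x := by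
    rintro u v huv ⟨i, rfl⟩ ⟨j, rfl⟩
    have hd := hT.dist_eq_dist_add_one_of_adj r huv
    rcases lt_trichotomy i j with h | rfl | h
    · have := hx _ _ h
      omega
    · exact huv.ne rfl
    · have := hx _ _ h
      omega
  let c : V → Fin 3 := fun v ↦
    if v ∈ Set.range x then 2 else if T.dist r v % 2 = 0 then 0 else 1
  have hc2 : ∀ v, c v = 2 ↔ v ∈ Set.range x := by
    intro v
    by_cases h : v ∈ Set.range x
    · simp only [c, if_pos h, h]
    · simp only [c, if_neg h, h]
      split_ifs <;> decide
  refine ⟨c, fun u v huv heq ↦ ?_, fun φ hφ ↦ ?_⟩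
  · by_cases hu : u ∈ Set.range x
    · exact hindep u v huv hu ((hc2 v).1 (heq ▸ (hc2 u).2 hu))
    · have hv : v ∉ Set.range x := fun hv ↦ hu ((hc2 u).1 (heq.trans ((hc2 v).2 hv)))
      have hd := hT.dist_eq_dist_add_one_of_adj r huv
      simp only [c, if_neg hu, if_neg hv] at heq
      split_ifs at heq
      · omega
      · exact absurd heq (by decide)
      · exact absurd heq (by decide)
      · omega
  · have hfix := φ.apply_seq_eq_of_sparse hc r x hx fun v hv ↦
      (hc2 _).1 ((hφ v).trans ((hc2 v).2 hv))
    have hs := hfix 2 le_rfl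
    refine hT.eq_self_of_fixes_infinite_branches hlf hmotion φ hs fun u hu ↦ ?_
    obtain ⟨k, hk⟩ := he (x 2, u)
    obtain ⟨j, hj, hjA⟩ := hxA k 2
    simp only [A, hk, if_pos hu] at hjA
    have hmem := φ.map_mem_branch hc hs hjA
    rw [hfix j hj] at hmem
    refine hT.eq_of_mem_branch hmem hjA ?_
    have := φ.dist_map hc (x 2) u
    rwa [hs] at this
end

section
/- Let T be an infinite tree whose maximum degree Δ is finite with Δ ≥ 3. Then T admits a proper vertex colouring with Δ colours that is preserved only by the identity automorphism; that is, χ_D(T) ≤ Δ. -/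
open SimpleGraph

/-- An orientation of a tree towards one of its ends, represented by a ray: every vertex has a
parent, adjacency means being parent and child, and all ancestor lines run into the ray. -/
structure RayOrientation {V : Type*} (T : SimpleGraph V) where
  /-- The neighbour of a vertex in the direction of the end. -/
  parent : V → V
  /-- The ray defining the end. -/
  ray : ℕ → V
  adj_iff : ∀ x y, T.Adj x y ↔ parent x = y ∨ parent y = x
  parent_parent_ne : ∀ x, parent (parent x) ≠ x
  parent_ray : ∀ n, parent (ray n) = ray (n + 1)
  ray_injective : Function.Injective ray
  exists_iterate_parent : ∀ x, ∃ k, parent^[k] x ∈ Set.range ray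

/-- In a tree every vertex other than the root `r` has a parent with respect to `r`. -/
lemma SimpleGraph.IsTree.exists_rootParent {V : Type*} {T : SimpleGraph V} (hT : T.IsTree)
    (r : V) : ∃ q : V → V, q r = r ∧ (∀ x, x ≠ r → T.Adj x (q x)) ∧
      ∀ x y, T.Adj x y → T.dist r x = T.dist r y + 1 → q x = y := by
  classical
  have key : ∀ x, ∃ y, (x = r → y = r) ∧ (x ≠ r → T.Adj x y) ∧
      ∀ z, T.Adj x z → T.dist r x = T.dist r z + 1 → y = z := by
    intro x
    obtain ⟨w, hw, -⟩ := hT.existsUnique_path r x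
    refine ⟨w.penultimate, ?_, ?_, ?_⟩
    · rintro rfl
      rw [Walk.eq_nil_iff_nil.mpr (Walk.isPath_iff_nil.mp hw)]
      rfl
    · intro hx
      exact (w.adj_penultimate (Walk.not_nil_of_ne hx.symm)).symm
    · intro z hz hd
      obtain ⟨u, hu, hul⟩ := hT.connected.exists_path_of_dist r z
      have hux : x ∉ u.support := fun hx ↦ by
        have := (T.dist_le (u.takeUntil x hx)).trans (u.length_takeUntil_le_length hx)
        lia
      rw [(hT.existsUnique_path r x).unique hw (hu.concat hux hz.symm), Walk.penultimate_concat]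
  choose q hq using key
  exact ⟨q, (hq r).1 rfl, fun x ↦ (hq x).2.1, fun x ↦ (hq x).2.2⟩

/-- A locally finite infinite tree contains a ray along which `q` steps back to the root. -/
lemma exists_ray_of_rootParent {V : Type*} [Infinite V] {r : V} {q : V → V}
    (hfin : ∀ x, {y | q y = x}.Finite) (hqr : q r = r) (hq : ∀ x, ∃ k, q^[k] x = r) :
    ∃ v : ℕ → V, v 0 = r ∧ ∀ n, v (n + 1) ≠ r ∧ q (v (n + 1)) = v n := by
  have step : ∀ x, {y | ∃ k, q^[k] y = x}.Infinite →
      ∃ z, z ≠ r ∧ q z = x ∧ {y | ∃ k, q^[k] y = z}.Infinite := by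
    intro x hx
    by_contra! h
    refine hx (((Set.finite_singleton x).union (((hfin x).inter_of_left {r}ᶜ).biUnion
      fun z hz ↦ h z hz.2 hz.1)).subset ?_)
    rintro y ⟨k, hk⟩
    induction k with
    | zero => exact Or.inl hk
    | succ k ih =>
      by_cases hr : q^[k] y = r
      · rw [Function.iterate_succ_apply', hr, hqr] at hk
        exact ih (hr.trans hk)
      · rw [Function.iterate_succ_apply'] at hk
        exact Or.inr (Set.mem_biUnion (x := q^[k] y) ⟨hk, hr⟩ ⟨k, rfl⟩)
  choose f hfr hqf hfi using step
  have hr : {y | ∃ k, q^[k] y = r}.Infinite := by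
    rw [Set.eq_univ_of_forall hq]
    exact Set.infinite_univ
  let v : ℕ → {x // {y | ∃ k, q^[k] y = x}.Infinite} :=
    Nat.rec ⟨r, hr⟩ fun _ x ↦ ⟨f x.1 x.2, hfi x.1 x.2⟩
  exact ⟨fun n ↦ (v n).1, rfl, fun n ↦ ⟨hfr _ _, hqf _ _⟩⟩

lemma SimpleGraph.IsTree.nonempty_rayOrientation {V : Type*} [Infinite V] {T : SimpleGraph V}
    (hT : T.IsTree) (hfin : ∀ x, (T.neighborSet x).Finite) : Nonempty (RayOrientation T) := by
  classical
  obtain ⟨r⟩ : Nonempty V := inferInstance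
  obtain ⟨q, hqr, hqa, hqu⟩ := hT.exists_rootParent r
  have hadj : ∀ x y, T.Adj x y → (x ≠ r ∧ q x = y) ∨ (y ≠ r ∧ q y = x) := by
    intro x y h
    rcases hT.dist_eq_dist_add_one_of_adj r h with hd | hd
    · exact Or.inl ⟨by rintro rfl; simp at hd, hqu x y h hd⟩
    · exact Or.inr ⟨by rintro rfl; simp at hd, hqu y x h.symm hd⟩
  have hd : ∀ x, x ≠ r → T.dist r x = T.dist r (q x) + 1 := by
    intro x hx
    obtain ⟨w, hw⟩ := hT.connected.exists_walk_length_eq_dist x r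
    cases w with
    | nil => exact absurd rfl hx
    | @cons _ y _ h w =>
      have hle := T.dist_le w
      rw [Walk.length_cons, dist_comm] at hw
      rw [dist_comm] at hle
      rcases hT.dist_eq_dist_add_one_of_adj r h with hd | hd
      · rw [hqu x y h hd, hd]
      · lia
  have hk : ∀ n x, T.dist r x = n → q^[n] x = r := by
    intro n
    induction n with
    | zero => exact fun x hx ↦ (hT.connected.dist_eq_zero_iff.mp hx).symm
    | succ n ih =>
      intro x hx
      have hxr : x ≠ r := by rintro rfl; simp at hx
      exact ih (q x) (by have := hd x hxr; lia)
  obtain ⟨v, hv0, hv⟩ := exists_ray_of_rootParent (r := r) (q := q)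
    (fun x ↦ ((hfin x).insert r).subset fun y hy ↦ by
      by_cases hyr : y = r
      · exact Or.inl hyr
      · exact Or.inr (hy ▸ (hqa y hyr).symm)) hqr (fun x ↦ ⟨_, hk _ x rfl⟩)
  have hdv : ∀ n, T.dist r (v n) = n := by
    intro n
    induction n with
    | zero => simp [hv0]
    | succ n ih => rw [hd _ (hv n).1, (hv n).2, ih]
  have hvinj : Function.Injective v := fun m n h ↦ by rw [← hdv m, h, hdv]
  let p : V → V := fun x ↦ if x ∈ Set.range v then v (T.dist r x + 1) else q x
  have hpv : ∀ n, p (v n) = v (n + 1) := fun n ↦ by simp [p, hdv]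
  have hpo : ∀ x, x ∉ Set.range v → p x = q x := fun x hx ↦ if_neg hx
  have hor : ∀ x, x ∉ Set.range v → x ≠ r := fun x hx h ↦ hx ⟨0, hv0.trans h.symm⟩
  refine ⟨⟨p, v, ?_, ?_, hpv, hvinj, ?_⟩⟩
  · have hp : ∀ x, T.Adj x (p x) := by
      intro x
      by_cases hx : x ∈ Set.range v
      · obtain ⟨n, rfl⟩ := hx
        rw [hpv]
        have := hqa _ (hv n).1
        rw [(hv n).2] at this
        exact this.symm
      · rw [hpo x hx]
        exact hqa x (hor x hx)
    have hqp : ∀ x, x ≠ r → p x = q x ∨ p (q x) = x := by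
      intro x hxr
      by_cases hx : x ∈ Set.range v
      · obtain ⟨n, rfl⟩ := hx
        cases n with
        | zero => exact absurd hv0 hxr
        | succ n => rw [(hv n).2]; exact Or.inr (hpv n)
      · exact Or.inl (hpo x hx)
    refine fun x y ↦ ⟨fun h ↦ ?_, ?_⟩
    · rcases hadj x y h with ⟨hr, rfl⟩ | ⟨hr, rfl⟩
      · exact hqp x hr
      · exact (hqp y hr).symm
    · rintro (rfl | rfl)
      · exact hp x
      · exact (hp y).symm
  · intro x hx
    by_cases hxv : x ∈ Set.range v
    · obtain ⟨n, rfl⟩ := hxv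
      rw [hpv, hpv] at hx
      have := hvinj hx
      lia
    · rw [hpo x hxv] at hx
      by_cases hqv : q x ∈ Set.range v
      · obtain ⟨n, hn⟩ := hqv
        rw [← hn, hpv] at hx
        exact hxv ⟨_, hx⟩
      · rw [hpo _ hqv] at hx
        have h1 := hd x (hor x hxv)
        have h2 := hd _ (hor _ hqv)
        rw [hx] at h2
        lia
  · intro x
    by_contra! h
    have hpq : ∀ k, p^[k] x = q^[k] x := by
      intro k
      induction k with
      | zero => rfl
      | succ k ih =>
        rw [Function.iterate_succ_apply', Function.iterate_succ_apply', ← ih, hpo _ (h k)]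
    exact h (T.dist r x) ⟨0, by rw [hpq, hk _ x rfl, hv0]⟩

/-- A function may be defined on a set `R` freely and elsewhere by recursion along `p`,
provided that all orbits of `p` meet `R`. -/
lemma exists_eqOn_and_recursion {V A : Type*} {p : V → V} {R : Set V}
    (hR : ∀ x, ∃ k, p^[k] x ∈ R) (s₀ : V → A) (G : V → A → A) :
    ∃ s : V → A, (∀ x ∈ R, s x = s₀ x) ∧ ∀ x ∉ R, s x = G x (s (p x)) := by
  classical
  let t : ℕ → V → A := Nat.rec s₀ fun _ f x ↦ G x (f (p x))
  refine ⟨fun x ↦ t (Nat.find (hR x)) x, fun x hx ↦ ?_, fun x hx ↦ ?_⟩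
  · have : Nat.find (hR x) = 0 := (Nat.find_eq_zero _).2 hx
    simp only [this]
    rfl
  · have : Nat.find (hR x) = Nat.find (hR (p x)) + 1 := Nat.find_comp_succ (hR x) (hR (p x)) hx
    simp only [this]
    rfl

lemma exists_ne_ne_fin {Δ : ℕ} (hΔ : 3 ≤ Δ) (a b : Fin Δ) : ∃ c, a ≠ c ∧ b ≠ c := by
  classical
  obtain ⟨c, hc⟩ := Finset.exists_mem_notMem_of_card_lt_card (s := {a, b}) (t := Finset.univ)
    (by rw [Finset.card_univ, Fintype.card_fin]; exact Finset.card_le_two.trans_lt hΔ)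
  simp only [Finset.mem_univ, Finset.mem_insert, Finset.mem_singleton, true_and, not_or] at hc
  exact ⟨c, Ne.symm hc.1, Ne.symm hc.2⟩

/-- With at least three colours, one can properly colour the path `ℕ` so that the pairs at
distance two having equal colours are prescribed. -/
lemma exists_nat_coloring {Δ : ℕ} (hΔ : 3 ≤ Δ) (E : ℕ → Prop) :
    ∃ a : ℕ → Fin Δ, (∀ n, a n ≠ a (n + 1)) ∧ ∀ n, a n = a (n + 2) ↔ E n := by
  classical
  have step : ∀ (n : ℕ) (x : {x : Fin Δ × Fin Δ // x.1 ≠ x.2}), ∃ c : Fin Δ,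
      x.1.2 ≠ c ∧ (x.1.1 = c ↔ E n) := by
    rintro n ⟨⟨a, b⟩, hab⟩
    by_cases hE : E n
    · exact ⟨a, hab.symm, by simp [hE]⟩
    · obtain ⟨c, hac, hbc⟩ := exists_ne_ne_fin hΔ a b
      exact ⟨c, hbc, by simp [hE, hac]⟩
  choose f hf hfE using step
  let s : ℕ → {x : Fin Δ × Fin Δ // x.1 ≠ x.2} :=
    Nat.rec ⟨(⟨0, by lia⟩, ⟨1, by lia⟩), by simp⟩ fun n x ↦ ⟨(x.1.2, f n x), hf n x⟩
  exact ⟨fun n ↦ (s n).1.1, fun n ↦ (s n).2, fun n ↦ hfE n (s n)⟩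

/-- A finite set `S` can be coloured injectively while avoiding the colour `a`, giving a chosen
point `u` the colour `e`, and using the colour `b` elsewhere when `S` has another point. -/
lemma exists_injOn_coloring {V : Type*} {S : Set V} (hS : S.Finite) {Δ : ℕ}
    (hcard : S.ncard + 1 ≤ Δ) {a b e : Fin Δ} (hab : a ≠ b) (hae : a ≠ e) {u : V} (hu : u ∈ S) :
    ∃ f : V → Fin Δ, Set.InjOn f S ∧ (∀ y ∈ S, f y ≠ a) ∧ f u = e ∧
      (2 ≤ S.ncard → e ≠ b → ∃ y ∈ S, f y = b) := by
  have : Nonempty (Fin Δ) := ⟨a⟩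
  obtain ⟨f, hfa, hf⟩ := hS.exists_injOn_of_encard_le (t := {a}ᶜ) (by
    rw [← hS.cast_ncard_eq, ← (Set.toFinite _).cast_ncard_eq, Nat.cast_le, Set.ncard_compl,
      Set.ncard_singleton, Nat.card_eq_fintype_card, Fintype.card_fin]
    lia)
  have hswap : ∀ (g : V → Fin Δ), Set.InjOn g S → (∀ y ∈ S, g y ≠ a) → ∀ w ∈ S, ∀ d, a ≠ d →
      Set.InjOn (fun y ↦ Equiv.swap (g w) d (g y)) S ∧
        ∀ y ∈ S, Equiv.swap (g w) d (g y) ≠ a := by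
    intro g hg hga w hw d hd
    refine ⟨fun x hx y hy h ↦ hg hx hy ((Equiv.swap _ _).injective h), fun y hy h ↦ ?_⟩
    rw [Equiv.swap_apply_eq_iff, Equiv.swap_apply_of_ne_of_ne (hga w hw).symm hd] at h
    exact hga y hy h
  obtain ⟨hg, hga⟩ := hswap f hf (fun y hy ↦ hfa hy) u hu e hae
  set g : V → Fin Δ := fun y ↦ Equiv.swap (f u) e (f y) with hgdef
  have hgu : g u = e := Equiv.swap_apply_left _ _
  by_cases h : 2 ≤ S.ncard ∧ e ≠ b
  · obtain ⟨w, hw, hwu⟩ := Set.exists_ne_of_one_lt_ncard h.1 u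
    obtain ⟨hk, hka⟩ := hswap g hg hga w hw b hab
    refine ⟨_, hk, hka, ?_, fun _ _ ↦ ⟨w, hw, Equiv.swap_apply_left _ _⟩⟩
    rw [hgu]
    refine Equiv.swap_apply_of_ne_of_ne (fun hew ↦ hwu ?_) h.2
    exact hg hw hu (hew.symm.trans hgu.symm)
  · exact ⟨g, hg, hga, hgu, fun h1 h2 ↦ absurd ⟨h1, h2⟩ h⟩

namespace RayOrientation

variable {V : Type*} {T : SimpleGraph V} (O : RayOrientation T)

/-- The children of a vertex: its neighbours other than the parent. -/
def children (x : V) : Set V := {y | O.parent y = x}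

lemma neighborSet_eq (x : V) : T.neighborSet x = insert (O.parent x) (O.children x) := by
  ext y
  simp [children, O.adj_iff, eq_comm]

lemma parent_notMem_children (x : V) : O.parent x ∉ O.children x := O.parent_parent_ne x

lemma finite_children {x : V} (h : (T.neighborSet x).Finite) : (O.children x).Finite :=
  h.subset (by rw [O.neighborSet_eq]; exact Set.subset_insert _ _)

lemma ncard_neighborSet {x : V} (h : (T.neighborSet x).Finite) :
    (T.neighborSet x).ncard = (O.children x).ncard + 1 := by
  rw [O.neighborSet_eq,
    Set.ncard_insert_of_notMem (O.parent_notMem_children x) (O.finite_children h)]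

lemma parent_mem_range_ray {x : V} (hx : x ∈ Set.range O.ray) :
    O.parent x ∈ Set.range O.ray := by
  obtain ⟨n, rfl⟩ := hx
  exact ⟨n + 1, (O.parent_ray n).symm⟩

lemma iterate_parent_ray (k n : ℕ) : O.parent^[k] (O.ray n) = O.ray (n + k) := by
  induction k with
  | zero => rfl
  | succ k ih => rw [Function.iterate_succ_apply', ih, O.parent_ray]; rfl

/-- The ray can be coloured arbitrarily, and the colouring extended so that siblings have
distinct colours, an only child outside the ray avoids its grandparent's colour, and the
colour of a ray vertex reappears on a grandchild whenever there is room for it. -/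
lemma exists_coloring {Δ : ℕ} (hΔ : 3 ≤ Δ) (hfin : ∀ x, (O.children x).Finite)
    (hcard : ∀ x, (O.children x).ncard + 1 ≤ Δ) (a : ℕ → Fin Δ) (ha : ∀ n, a n ≠ a (n + 1)) :
    ∃ c : V → Fin Δ, (∀ n, c (O.ray n) = a n) ∧ (∀ x, c x ≠ c (O.parent x)) ∧
      (∀ x, Set.InjOn c (O.children x)) ∧
      (∀ x ∉ Set.range O.ray, (O.children x).ncard = 1 →
        ∀ y ∈ O.children x, c y ≠ c (O.parent x)) ∧
      ∀ n, 2 ≤ (O.children (O.ray (n + 1))).ncard → a n ≠ a (n + 2) →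
        ∃ y ∈ O.children (O.ray (n + 1)), c y = a (n + 2) := by
  let P (x : V) (α β : Fin Δ) (f : V → Fin Δ) : Prop :=
    Set.InjOn f (O.children x) ∧ (∀ y ∈ O.children x, f y ≠ α) ∧
    (x ∉ Set.range O.ray → (O.children x).ncard = 1 → ∀ y ∈ O.children x, f y ≠ β) ∧
    ∀ n, x = O.ray (n + 1) → f (O.ray n) = a n ∧
      (2 ≤ (O.children x).ncard → a n ≠ β → ∃ y ∈ O.children x, f y = β)
  have local_coloring : ∀ x α β, ∃ f, α ≠ β → (∀ n, x = O.ray n → α = a n) → P x α β f := by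
    intro x α β
    by_cases hαβ : α ≠ β
    swap
    · exact ⟨fun _ ↦ α, fun h ↦ absurd h hαβ⟩
    by_cases hx : ∃ n, x = O.ray (n + 1)
    · obtain ⟨n, rfl⟩ := hx
      by_cases hα : α = a (n + 1)
      swap
      · exact ⟨fun _ ↦ α, fun _ h ↦ absurd (h _ rfl) hα⟩
      obtain ⟨f, h1, h2, h3, h4⟩ := exists_injOn_coloring (hfin _) (hcard _) hαβ
        (hα ▸ (ha n).symm) (O.parent_ray n : O.ray n ∈ O.children (O.ray (n + 1)))
      refine ⟨f, fun _ _ ↦ ⟨h1, h2, fun h ↦ absurd ⟨_, rfl⟩ h, fun m hm ↦ ?_⟩⟩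
      obtain rfl : n = m := by simpa using O.ray_injective hm
      exact ⟨h3, h4⟩
    · push Not at hx
      rcases (O.children x).eq_empty_or_nonempty with hS | ⟨u, hu⟩
      · exact ⟨fun _ ↦ α, fun _ _ ↦ ⟨by simp [hS], by simp [hS], by simp [hS],
          fun n hn ↦ absurd hn (hx n)⟩⟩
      · obtain ⟨e, hαe, hβe⟩ := exists_ne_ne_fin hΔ α β
        obtain ⟨f, h1, h2, h3, -⟩ := exists_injOn_coloring (hfin x) (hcard x) hαβ hαe hu
        refine ⟨f, fun _ _ ↦ ⟨h1, h2, fun _ hS y hy ↦ ?_, fun n hn ↦ absurd hn (hx n)⟩⟩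
        rw [Set.ncard_le_one_iff (hfin x) |>.mp hS.le hy hu, h3]
        exact hβe.symm
  choose F hF using local_coloring
  obtain ⟨s, hsR, hs⟩ := exists_eqOn_and_recursion O.exists_iterate_parent
    (fun x ↦ (a (Function.invFun O.ray x), a (Function.invFun O.ray x + 1)))
    (fun x t ↦ (F (O.parent x) t.1 t.2 x, t.1))
  have hray : ∀ n, s (O.ray n) = (a n, a (n + 1)) := by
    intro n
    rw [hsR _ ⟨n, rfl⟩, Function.leftInverse_invFun O.ray_injective n]
  have hsnd : ∀ x, (s x).2 = (s (O.parent x)).1 := by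
    intro x
    by_cases hx : x ∈ Set.range O.ray
    · obtain ⟨n, rfl⟩ := hx
      rw [O.parent_ray, hray, hray]
    · rw [hs x hx]
  have hP : ∀ x, (s x).1 ≠ (s x).2 → P x (s x).1 (s x).2 (F x (s x).1 (s x).2) := by
    intro x hx
    refine hF x _ _ hx ?_
    rintro n rfl
    rw [hray]
  have hne : ∀ k x, O.parent^[k] x ∈ Set.range O.ray → (s x).1 ≠ (s x).2 := by
    intro k
    induction k with
    | zero =>
      rintro _ ⟨n, rfl⟩
      rw [hray]
      exact ha n
    | succ k ih =>
      intro x hx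
      by_cases hxR : x ∈ Set.range O.ray
      · obtain ⟨n, rfl⟩ := hxR
        rw [hray]
        exact ha n
      · rw [hs x hxR]
        exact (hP _ (ih _ hx)).2.1 x rfl
  have hne : ∀ x, (s x).1 ≠ (s x).2 := fun x ↦ (O.exists_iterate_parent x).elim fun k ↦ hne k x
  have hc : ∀ x, ∀ y ∈ O.children x, (s y).1 = F x (s x).1 (s x).2 y := by
    rintro x y rfl
    by_cases hy : y ∈ Set.range O.ray
    · obtain ⟨n, rfl⟩ := hy
      rw [((hP _ (hne _)).2.2.2 n (O.parent_ray n)).1, hray]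
    · rw [hs y hy]
  refine ⟨fun x ↦ (s x).1, fun n ↦ congrArg Prod.fst (hray n),
    fun x ↦ (hne x).trans_eq (hsnd x), fun x ↦ ?_, ?_, ?_⟩
  · exact (hP x (hne x)).1.congr fun y hy ↦ (hc x y hy).symm
  · intro x hx hS y hy
    simp only [hc x y hy, ← hsnd]
    exact (hP x (hne x)).2.2.1 hx hS y hy
  · intro n hS hn
    have hβ : (s (O.ray (n + 1))).2 = a (n + 2) := by rw [hray]
    obtain ⟨y, hy, hyβ⟩ := ((hP _ (hne (O.ray (n + 1)))).2.2.2 n rfl).2 hS (hβ ▸ hn)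
    exact ⟨y, hy, (hc _ y hy).trans (hyβ.trans hβ)⟩

/-- An automorphism that reverses the direction of an edge also reverses the next one. -/
lemma parent_map_parent_eq (φ : T ≃g T) {x : V} (h : O.parent (φ x) ≠ φ (O.parent x)) :
    O.parent (φ (O.parent x)) = φ x := by
  have := φ.map_adj_iff.mpr ((O.adj_iff x _).mpr (Or.inl rfl))
  exact ((O.adj_iff _ _).mp this).resolve_left h

lemma parent_map_parent_ne (φ : T ≃g T) {x : V} (h : O.parent (φ x) ≠ φ (O.parent x)) :
    O.parent (φ (O.parent x)) ≠ φ (O.parent (O.parent x)) := by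
  rw [O.parent_map_parent_eq φ h]
  exact fun h ↦ O.parent_parent_ne x (φ.injective h).symm

/-- An automorphism commuting with `parent`, preserving a colouring that separates siblings and
fixing a vertex of the ray is the identity. -/
lemma eq_of_map_ray_eq {α : Type*} {c : V → α} (hc : ∀ x, Set.InjOn c (O.children x))
    (φ : T ≃g T) (hφ : ∀ v, c (φ v) = c v) (hp : ∀ x, O.parent (φ x) = φ (O.parent x)) {k : ℕ}
    (hk : φ (O.ray k) = O.ray k) (x : V) : φ x = x := by
  have down : ∀ j x, φ (O.parent^[j] x) = O.parent^[j] x → φ x = x := by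
    intro j
    induction j with
    | zero => exact fun _ h ↦ h
    | succ j ih =>
      intro x h
      have h := ih _ h
      exact hc (O.parent x) ((hp x).trans h) rfl (hφ x)
  obtain ⟨j, n, hj⟩ := O.exists_iterate_parent x
  refine down (k + j) x ?_
  have hcomm : Function.Commute φ O.parent := fun y ↦ (hp y).symm
  rw [Function.iterate_add_apply, ← hj, O.iterate_parent_ray, add_comm, ← O.iterate_parent_ray,
    (hcomm.iterate_right n).eq, hk]

/-- An automorphism commuting with `parent` eventually acts on the ray as a translation. -/
lemma exists_map_ray_eq (φ : T ≃g T) (hp : ∀ x, O.parent (φ x) = φ (O.parent x)) :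
    ∃ k m, ∀ i, φ (O.ray (k + i)) = O.ray (m + i) := by
  obtain ⟨k, m, hk⟩ := O.exists_iterate_parent (φ (O.ray 0))
  have hcomm : Function.Commute φ O.parent := fun y ↦ (hp y).symm
  refine ⟨k, m, fun i ↦ ?_⟩
  rw [add_comm, ← O.iterate_parent_ray i m, hk, ← Function.iterate_add_apply,
    ← (hcomm.iterate_right (i + k)).eq, O.iterate_parent_ray, zero_add]

/-- An automorphism not commuting with `parent` eventually moves the ray off itself, with
reversed direction. -/
lemma exists_map_ray_notMem (φ : T ≃g T) {x : V} (hx : O.parent (φ x) ≠ φ (O.parent x)) :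
    ∃ N, ∀ n ≥ N, φ (O.ray n) ∉ Set.range O.ray ∧
      O.parent (φ (O.ray (n + 1))) = φ (O.ray n) := by
  have hiter : ∀ k, O.parent (φ (O.parent^[k] x)) ≠ φ (O.parent (O.parent^[k] x)) := by
    intro k
    induction k with
    | zero => exact hx
    | succ k ih =>
      rw [Function.iterate_succ_apply']
      exact O.parent_map_parent_ne φ ih
  obtain ⟨k, m, hm⟩ := O.exists_iterate_parent x
  have hrev : ∀ i, O.parent (φ (O.ray (m + i + 1))) = φ (O.ray (m + i)) := by
    intro i
    have := O.parent_map_parent_eq φ (hiter (i + k))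
    rwa [Function.iterate_add_apply, ← hm, O.iterate_parent_ray, O.parent_ray] at this
  have hrevk : ∀ i j, O.parent^[j] (φ (O.ray (m + i + j))) = φ (O.ray (m + i)) := by
    intro i j
    induction j with
    | zero => rfl
    | succ j ih =>
      have h : O.parent (φ (O.ray (m + i + (j + 1)))) = φ (O.ray (m + i + j)) := by
        simpa only [add_assoc] using hrev (i + j)
      rw [Function.iterate_succ_apply, h, ih]
  obtain ⟨i, hi⟩ : ∃ i, φ (O.ray (m + i)) ∉ Set.range O.ray := by
    by_contra! h
    obtain ⟨j, hj⟩ := h 0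
    obtain ⟨l, hl⟩ := h (0 + (j + 1))
    have := hrevk 0 (j + 1)
    rw [← hj, add_assoc, ← hl, O.iterate_parent_ray] at this
    have := O.ray_injective this
    lia
  have hoff : ∀ j, φ (O.ray (m + i + j)) ∉ Set.range O.ray := by
    intro j
    induction j with
    | zero => exact hi
    | succ j ih =>
      refine fun h ↦ ih ?_
      have := O.parent_mem_range_ray h
      rwa [← add_assoc, add_assoc m, hrev, ← add_assoc] at this
  refine ⟨m + i, fun n hn ↦ ?_⟩
  obtain ⟨j, rfl⟩ := Nat.exists_eq_add_of_le hn
  exact ⟨hoff j, by rw [add_assoc m]; exact hrev _⟩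

end RayOrientation

/-- The set of powers of two is not eventually invariant under a nonzero translation. -/
lemma eq_of_two_pow_translation {k m : ℕ}
    (h : ∀ i, (∃ j, k + i = 2 ^ j) ↔ ∃ j, m + i = 2 ^ j) : k = m := by
  wlog hkm : k < m generalizing k m
  · rcases lt_or_eq_of_le (not_lt.mp hkm) with hlt | heq
    · exact (this (fun i ↦ (h i).symm) hlt).symm
    · exact heq.symm
  have hm : m < 2 ^ m := Nat.lt_two_pow_self
  obtain ⟨j, hj⟩ := (h (2 ^ m - k)).mp ⟨m, by lia⟩
  have h1 : 2 ^ m < 2 ^ j := by lia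
  have h2 : 2 ^ j < 2 ^ (m + 1) := by rw [pow_succ]; lia
  rw [Nat.pow_lt_pow_iff_right (by norm_num)] at h1 h2
  lia

/-- An infinite tree with finite maximum degree `Δ ≥ 3` admits a proper distinguishing
vertex colouring with `Δ` colours; i.e. `χ_D(T) ≤ Δ`. -/
theorem tree_distinguishingChromaticNumber_le_maxDegree
    {V : Type*} [Infinite V] (T : SimpleGraph V) (hT : T.IsTree) (Δ : ℕ) (hΔ : 3 ≤ Δ)
    (hdeg : ∀ v, (T.neighborSet v).Finite ∧ (T.neighborSet v).ncard ≤ Δ)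
    (hmax : ∃ v, (T.neighborSet v).ncard = Δ) :
    ∃ c : V → Fin Δ,
      IsProperVertexColoring T c ∧ IsDistinguishingVertexColoring T c := by
  classical
  obtain ⟨O⟩ := hT.nonempty_rayOrientation fun x ↦ (hdeg x).1
  have hfin : ∀ x, (O.children x).Finite := fun x ↦ O.finite_children (hdeg x).1
  have hcard : ∀ x, (O.children x).ncard + 1 ≤ Δ := fun x ↦
    O.ncard_neighborSet (hdeg x).1 ▸ (hdeg x).2
  obtain ⟨a, ha, haE⟩ := exists_nat_coloring hΔ fun n ↦
    ((∃ j, n = 2 ^ j) ↔ (O.children (O.ray (n + 1))).ncard = 1)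
  obtain ⟨c, hcray, hcp, hcinj, hcoff, hcdup⟩ := O.exists_coloring hΔ hfin hcard a ha
  refine ⟨c, fun u v huv ↦ ?_, fun φ hφ ↦ ?_⟩
  · rcases (O.adj_iff u v).mp huv with rfl | rfl
    · exact hcp u
    · exact (hcp v).symm
  have hncard : ∀ x, (O.children (φ x)).ncard = (O.children x).ncard := by
    intro x
    have h : φ '' T.neighborSet x = T.neighborSet (φ x) := φ.image_neighborSet
    have := Set.ncard_image_of_injective (T.neighborSet x) φ.injective
    rw [h, O.ncard_neighborSet (hdeg _).1, O.ncard_neighborSet (hdeg _).1] at this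
    lia
  by_cases hp : ∀ x, O.parent (φ x) = φ (O.parent x)
  · obtain ⟨k, m, hkm⟩ := O.exists_map_ray_eq φ hp
    have hacol : ∀ i, a (k + i) = a (m + i) := fun i ↦ by
      rw [← hcray, ← hcray, ← hkm, hφ]
    have : k = m := by
      refine eq_of_two_pow_translation fun i ↦ ?_
      have h1 := haE (k + i)
      have h2 := haE (m + i)
      rw [add_assoc, hacol, hacol, ← hncard, add_assoc, hkm] at h1
      rw [add_assoc, add_assoc] at h2
      tauto
    subst this
    exact O.eq_of_map_ray_eq hcinj φ hφ hp (hkm 0)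
  · push Not at hp
    obtain ⟨x, hx⟩ := hp
    obtain ⟨N, hN⟩ := O.exists_map_ray_notMem φ hx
    exfalso
    set n := 2 ^ N with hn
    have hNn : N ≤ n := Nat.lt_two_pow_self.le
    obtain ⟨hw, hwp'⟩ := hN (n + 1) (by lia)
    have hwp := (hN n hNn).2
    have hE := (haE n).trans (iff_true_left ⟨N, hn⟩)
    by_cases hS : (O.children (O.ray (n + 1))).ncard = 1
    · refine hcoff _ hw ((hncard _).trans hS) _ hwp' ?_
      rw [hwp, hφ, hφ, hcray, hcray]
      exact (hE.mpr hS).symm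
    · have han : a n ≠ a (n + 2) := mt hE.mp hS
      have hpos : 0 < (O.children (O.ray (n + 1))).ncard :=
        (Set.ncard_pos (hfin _)).mpr ⟨O.ray n, O.parent_ray n⟩
      obtain ⟨y, hy, hyc⟩ := hcdup n (by lia) han
      have hadj : T.Adj (φ (O.ray (n + 1))) (φ y) :=
        φ.map_adj_iff.mpr ((O.adj_iff _ _).mpr (Or.inr hy))
      rcases (O.adj_iff _ _).mp hadj with h | h
      · have : y = O.ray n := φ.injective (h.symm.trans hwp)
        rw [this, hcray] at hyc
        exact han hyc
      · have : φ y = φ (O.ray (n + 2)) :=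
          hcinj _ h hwp' (by rw [hφ, hφ, hyc, hcray])
        rw [φ.injective this] at hy
        refine O.parent_notMem_children (O.ray (n + 1)) ?_
        rwa [O.parent_ray]
end

section
/- Let G be a connected infinite simple graph and let k be a natural number. If G admits a proper total colouring with k colours, then G admits a proper total colouring with k + 1 colours that is preserved only by the identity automorphism; that is, χ''_D(G) ≤ χ''(G) + 1. -/
open SimpleGraph

/-- In a connected graph, an automorphism that fixes a vertex and preserves a proper edge
colouring is the identity. -/
theorem IsProperEdgeColoring.eq_self_of_fixes {V α : Type*} {G : SimpleGraph V}
    {c : Sym2 V → α} (hc : IsProperEdgeColoring G c) (hG : G.Connected) (φ : G ≃g G)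
    (hφ : ∀ u v, G.Adj u v → c s(φ u, φ v) = c s(u, v)) {r : V} (hr : φ r = r) (v : V) :
    φ v = v := by
  obtain ⟨p⟩ := hG.preconnected r v
  induction p with
  | nil => exact hr
  | @cons u w _ huw _ ih =>
    refine ih ?_
    by_contra hne
    have hadj : G.Adj u (φ w) := hr ▸ φ.map_adj_iff.2 huw
    exact hc u (φ w) w hadj huw hne (by simpa only [hr] using hφ u w huw)

/-- Recolouring a single vertex with a new colour keeps a total colouring proper. -/
theorem IsProperTotalColoring.update_last {V : Type*} [DecidableEq V] {G : SimpleGraph V}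
    {k : ℕ} {cv : V → Fin k} {ce : Sym2 V → Fin k} (h : IsProperTotalColoring G cv ce) (r : V) :
    IsProperTotalColoring G (Function.update (fun v => (cv v).castSucc) r (Fin.last k))
      (fun e => (ce e).castSucc) := by
  obtain ⟨hv, he, hve⟩ := h
  refine ⟨fun u v huv => ?_, fun u v w huv huw hvw heq => ?_, fun u v huv => ?_⟩
  · by_cases hu : u = r <;> by_cases hw : v = r
    · exact absurd (hu.trans hw.symm) huv.ne
    · simpa [hu, hw] using (Fin.castSucc_ne_last (cv v)).symm
    · simp [hu, hw, Fin.castSucc_ne_last]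
    · simpa [hu, hw] using hv u v huv
  · exact he u v w huv huw hvw (Fin.castSucc_injective k heq)
  · by_cases hu : u = r
    · simpa [hu] using (Fin.castSucc_ne_last (ce s(r, v))).symm
    · simpa [hu] using hve u v huv

/-- If a connected infinite graph admits a proper total colouring with `k` colours, then
it admits a proper distinguishing total colouring with `k + 1` colours;
i.e. `χ''_D(G) ≤ χ''(G) + 1`. -/
theorem totalDistinguishingChromaticNumber_le_totalChromaticNumber_add_one
    {V : Type*} [Infinite V] (G : SimpleGraph V) (hG : G.Connected) (k : ℕ)
    (cv : V → Fin k) (ce : Sym2 V → Fin k) (h : IsProperTotalColoring G cv ce) :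
    ∃ (cv' : V → Fin (k + 1)) (ce' : Sym2 V → Fin (k + 1)),
      IsProperTotalColoring G cv' ce' ∧ IsDistinguishingTotalColoring G cv' ce' := by
  classical
  obtain ⟨r⟩ := hG.nonempty
  have h' := h.update_last r
  refine ⟨_, _, h', fun φ ⟨hφv, hφe⟩ => ?_⟩
  refine IsProperEdgeColoring.eq_self_of_fixes (c := fun e => (ce e).castSucc) h'.2.1 hG φ hφe (r := r) ?_
  by_contra hne
  have hcol := hφv r
  rw [Function.update_of_ne hne, Function.update_self] at hcol
  exact Fin.castSucc_ne_last _ hcol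
end
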